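/- In any complete first-order theory T, among the relations ⫝ between small subsets of 𝕄 over elementary submodels that imply ⫝ʰ and satisfy invariance, monotonicity, existence, right extension, and the coheir chain condition, there exists a weakest one ⫝^CK: that is, such a relation ⫝^CK exists, and every relation ⫝ with these properties satisfies that A ⫝_M B implies A ⫝^CK_M B. -/

import Mathlib

/- Common model-theoretic infrastructure for formalizing
   "NSOP₂ theories are NSOP₁" (arXiv:2206.08512).

   We work with a monster model `𝕄` of a complete theory: a sufficiently
   saturated and strongly homogeneous `L`-structure.  Tuples are functions
   `α → 𝕄`; sets of formulas with parameters are coded via `FmlP`. -/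

open FirstOrder Language

universe u v w

namespace NSOP2Paper

/-- A first-order formula in free variables `α ⊕ Fin n` together with an
`n`-tuple of parameters from `𝕄`. -/
abbrev FmlP (L : FirstOrder.Language.{u, u}) (𝕄 : Type u) (α : Type v) :=
  Σ n : ℕ, L.Formula (α ⊕ Fin n) × (Fin n → 𝕄)

/-- `a ≡_C b` : the tuples `a` and `b` satisfy the same formulas with
parameters from `C`. -/
def EqTpOver (L : FirstOrder.Language.{u, u}) {𝕄 : Type u} [L.Structure 𝕄] (C : Set 𝕄)
    {α : Type v} (a b : α → 𝕄) : Prop :=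
  ∀ (n : ℕ) (φ : L.Formula (α ⊕ Fin n)) (c : Fin n → 𝕄), (∀ i, c i ∈ C) →
    (φ.Realize (Sum.elim a c) ↔ φ.Realize (Sum.elim b c))

/-- `tp(a / C)` is finitely satisfiable in `Ms`: every formula over `C`
satisfied by `a` has a realization by a tuple from `Ms`. -/
def FinSatIn (L : FirstOrder.Language.{u, u}) {𝕄 : Type u} [L.Structure 𝕄] (Ms : Set 𝕄)
    {α : Type v} (a : α → 𝕄) (C : Set 𝕄) : Prop :=
  ∀ (n : ℕ) (φ : L.Formula (α ⊕ Fin n)) (c : Fin n → 𝕄), (∀ i, c i ∈ C) →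
    φ.Realize (Sum.elim a c) →
    ∃ m : α → 𝕄, (∀ i, m i ∈ Ms) ∧ φ.Realize (Sum.elim m c)

/-- `Ms` is the underlying set of a (small) elementary submodel of `𝕄`. -/
def IsElemSubmodel (L : FirstOrder.Language.{u, u}) {𝕄 : Type u} [L.Structure 𝕄] (Ms : Set 𝕄) : Prop :=
  ∃ S : L.ElementarySubstructure 𝕄, (S : Set 𝕄) = Ms

/-- A complete consistent global type (a complete type over the monster `𝕄`)
in variables `α`, coded as the set of formulas-with-parameters it contains. -/
structure GlobalType (L : FirstOrder.Language.{u, u}) (𝕄 : Type u) [L.Structure 𝕄] (α : Type v) where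
  carrier : Set (FmlP L 𝕄 α)
  consistent : ∀ t : Finset (FmlP L 𝕄 α), ↑t ⊆ carrier →
    ∃ a : α → 𝕄, ∀ p ∈ t, p.2.1.Realize (Sum.elim a p.2.2)
  complete : ∀ (n : ℕ) (φ : L.Formula (α ⊕ Fin n)) (c : Fin n → 𝕄),
    (⟨n, (φ, c)⟩ : FmlP L 𝕄 α) ∈ carrier ∨ (⟨n, (φ.not, c)⟩ : FmlP L 𝕄 α) ∈ carrier

variable {L : FirstOrder.Language.{u, u}} {𝕄 : Type u} [L.Structure 𝕄]

/-- The global type `q` is finitely satisfiable in `Ms` (i.e. it is a coheir of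
its restriction to `Ms`). -/
def GlobalType.FinSatInM {α : Type v} (q : GlobalType L 𝕄 α) (Ms : Set 𝕄) : Prop :=
  ∀ t : Finset (FmlP L 𝕄 α), ↑t ⊆ q.carrier →
    ∃ m : α → 𝕄, (∀ i, m i ∈ Ms) ∧ ∀ p ∈ t, p.2.1.Realize (Sum.elim m p.2.2)

/-- `a ⊨ q|_C` : the tuple `a` realizes the restriction of the global type `q`
to parameters from `C`. -/
def RealizesType {α : Type v} (q : GlobalType L 𝕄 α) (a : α → 𝕄) (C : Set 𝕄) : Prop :=
  ∀ (n : ℕ) (φ : L.Formula (α ⊕ Fin n)) (c : Fin n → 𝕄), (∀ i, c i ∈ C) →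
    (⟨n, (φ, c)⟩ : FmlP L 𝕄 α) ∈ q.carrier → φ.Realize (Sum.elim a c)

/-- The global type `q` extends `tp(a / C)`. -/
def ExtendsTpOver {α : Type v} (q : GlobalType L 𝕄 α) (C : Set 𝕄) (a : α → 𝕄) : Prop :=
  ∀ (n : ℕ) (φ : L.Formula (α ⊕ Fin n)) (c : Fin n → 𝕄), (∀ i, c i ∈ C) →
    φ.Realize (Sum.elim a c) → (⟨n, (φ, c)⟩ : FmlP L 𝕄 α) ∈ q.carrier

/-- `B` is a coheir Morley sequence over `Ms` in the global type `q`: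
`q` is finitely satisfiable in `Ms` and `B i ⊨ q|_(Ms ∪ B_{<i})`. -/
def MorleyIn {α : Type v} (q : GlobalType L 𝕄 α) (Ms : Set 𝕄) (B : ℕ → α → 𝕄) : Prop :=
  q.FinSatInM Ms ∧
    ∀ i : ℕ, RealizesType q (B i) (Ms ∪ ⋃ (j : ℕ) (_ : j < i), Set.range (B j))

/-- `B` is a coheir Morley sequence over `Ms`. -/
def CoheirMorley (L : FirstOrder.Language.{u, u}) {𝕄 : Type u} [L.Structure 𝕄] (Ms : Set 𝕄)
    {α : Type v} (B : ℕ → α → 𝕄) : Prop :=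
  ∃ q : GlobalType L 𝕄 α, MorleyIn q Ms B

/-- Flatten an `ℕ`-indexed sequence of `α`-tuples into a single tuple. -/
def flatSeq {α : Type v} (I : ℕ → α → 𝕄) : ℕ × α → 𝕄 := fun p => I p.1 p.2

/-- The sequence `I` is indiscernible over `C`. -/
def IndiscernibleOver (L : FirstOrder.Language.{u, u}) {𝕄 : Type u} [L.Structure 𝕄] (C : Set 𝕄)
    {α : Type v} (I : ℕ → α → 𝕄) : Prop :=
  ∀ (n : ℕ) (f g : Fin n → ℕ), StrictMono f → StrictMono g →
    EqTpOver L C (fun p : Fin n × α => I (f p.1) p.2) (fun p : Fin n × α => I (g p.1) p.2)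

/-- `𝕄` is `κ`-saturated: every finitely satisfiable set of formulas in fewer
than `κ` variables over a parameter set of size `< κ` is realized in `𝕄`. -/
def IsSaturated (L : FirstOrder.Language.{u, u}) (𝕄 : Type u) [L.Structure 𝕄] (κ : Cardinal.{u}) : Prop :=
  ∀ (α : Type u) (A : Set 𝕄), Cardinal.mk α < κ → Cardinal.mk A < κ →
    ∀ Γ : Set (FmlP L 𝕄 α), (∀ p ∈ Γ, ∀ i, p.2.2 i ∈ A) →
      (∀ t : Finset (FmlP L 𝕄 α), ↑t ⊆ Γ →
        ∃ a : α → 𝕄, ∀ p ∈ t, p.2.1.Realize (Sum.elim a p.2.2)) →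
      ∃ a : α → 𝕄, ∀ p ∈ Γ, p.2.1.Realize (Sum.elim a p.2.2)

/-- `𝕄` is strongly `κ`-homogeneous: partial elementary maps between tuples of
length `< κ` extend to automorphisms of `𝕄`. -/
def IsStronglyHomogeneous (L : FirstOrder.Language.{u, u}) (𝕄 : Type u) [L.Structure 𝕄]
    (κ : Cardinal.{u}) : Prop :=
  ∀ (α : Type u), Cardinal.mk α < κ → ∀ a b : α → 𝕄, EqTpOver L (∅ : Set 𝕄) a b →
    ∃ σ : 𝕄 ≃[L] 𝕄, ∀ i, σ (a i) = b i

/-- `𝕄` is a monster model (for smallness degree `κ`): sufficiently saturated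
and strongly homogeneous. -/
def IsMonster (L : FirstOrder.Language.{u, u}) (𝕄 : Type u) [L.Structure 𝕄] (κ : Cardinal.{u}) : Prop :=
  Cardinal.aleph0 < κ ∧ IsSaturated L 𝕄 κ ∧ IsStronglyHomogeneous L 𝕄 κ

/-! ### Tree combinatorics -/

/-- The meet (longest common prefix) of two finite sequences. -/
def meet {A : Type w} [DecidableEq A] : List A → List A → List A
  | a :: as, b :: bs => if a = b then a :: meet as bs else []
  | _, _ => []

/-- The meet of `η 0, …, η i`. -/
def combMeet {A : Type w} [DecidableEq A] {k : ℕ} (η : Fin k → List A) (i : Fin k) : List A :=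
  (List.ofFn fun j : Fin i.val => η (Fin.castLE i.2.le j)).foldl meet (η i)

/-- `η 0, …, η (k-1)` is a descending comb: a lexicographically increasing
antichain such that the meet of `η 0, …, η (i+1)` is a proper initial segment
of the meet of `η 0, …, η i`. -/
def DescendingComb {A : Type w} [DecidableEq A] [LT A] {k : ℕ} (η : Fin k → List A) : Prop :=
  (∀ i j : Fin k, i ≠ j → ¬ η i <+: η j) ∧
  (∀ i j : Fin k, i < j → List.Lex (· < ·) (η i) (η j)) ∧
  (∀ (i : ℕ) (h : i + 1 < k),
    combMeet η ⟨i + 1, h⟩ <+: combMeet η ⟨i, by omega⟩ ∧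
    combMeet η ⟨i + 1, h⟩ ≠ combMeet η ⟨i, by omega⟩)

/-! ### Tree properties of theories (witnessed in the monster model) -/

/-- `T = Th(𝕄)` has `SOP₁`. -/
def HasSOP1 (L : FirstOrder.Language.{u, u}) (𝕄 : Type u) [L.Structure 𝕄] : Prop :=
  ∃ (k m : ℕ) (φ : L.Formula (Fin k ⊕ Fin m)) (b : List Bool → Fin m → 𝕄),
    (∀ σ : ℕ → Bool, ∃ a : Fin k → 𝕄,
      ∀ n : ℕ, φ.Realize (Sum.elim a (b (List.ofFn fun i : Fin n => σ i)))) ∧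
    ∀ η₁ η₂ : List Bool, (η₁ ++ [false]) <+: η₂ →
      ¬ ∃ a : Fin k → 𝕄, φ.Realize (Sum.elim a (b η₂)) ∧
        φ.Realize (Sum.elim a (b (η₁ ++ [true])))

/-- `T = Th(𝕄)` has `SOP₂`. -/
def HasSOP2 (L : FirstOrder.Language.{u, u}) (𝕄 : Type u) [L.Structure 𝕄] : Prop :=
  ∃ (k m : ℕ) (φ : L.Formula (Fin k ⊕ Fin m)) (b : List Bool → Fin m → 𝕄),
    (∀ σ : ℕ → Bool, ∃ a : Fin k → 𝕄,
      ∀ n : ℕ, φ.Realize (Sum.elim a (b (List.ofFn fun i : Fin n => σ i)))) ∧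
    ∀ η₁ η₂ : List Bool, ¬ η₁ <+: η₂ → ¬ η₂ <+: η₁ →
      ¬ ∃ a : Fin k → 𝕄, φ.Realize (Sum.elim a (b η₁)) ∧ φ.Realize (Sum.elim a (b η₂))

/-- `T = Th(𝕄)` has `k`-`DCTP₁`: paths are consistent but descending combs of
size `k` are inconsistent. -/
def HasKDCTP1 (L : FirstOrder.Language.{u, u}) (𝕄 : Type u) [L.Structure 𝕄] (k : ℕ) : Prop :=
  ∃ (r m : ℕ) (φ : L.Formula (Fin r ⊕ Fin m)) (b : List ℕ → Fin m → 𝕄),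
    (∀ σ : ℕ → ℕ, ∃ a : Fin r → 𝕄,
      ∀ n : ℕ, φ.Realize (Sum.elim a (b (List.ofFn fun i : Fin n => σ i)))) ∧
    ∀ η : Fin k → List ℕ, DescendingComb η →
      ¬ ∃ a : Fin r → 𝕄, ∀ i, φ.Realize (Sum.elim a (b (η i)))

/-- `T = Th(𝕄)` has weak `k`-`TP₁`: paths are consistent but any `k` pairwise
incomparable nodes with common pairwise meet are inconsistent. -/
def HasWeakKTP1 (L : FirstOrder.Language.{u, u}) (𝕄 : Type u) [L.Structure 𝕄] (k : ℕ) : Prop :=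
  ∃ (r m : ℕ) (φ : L.Formula (Fin r ⊕ Fin m)) (b : List ℕ → Fin m → 𝕄),
    (∀ σ : ℕ → ℕ, ∃ a : Fin r → 𝕄,
      ∀ n : ℕ, φ.Realize (Sum.elim a (b (List.ofFn fun i : Fin n => σ i)))) ∧
    ∀ η : Fin k → List ℕ,
      (∀ i j, i ≠ j → ¬ η i <+: η j) →
      (∀ i j i' j' : Fin k, i ≠ j → i' ≠ j' → meet (η i) (η j) = meet (η i') (η j')) →
      ¬ ∃ a : Fin r → 𝕄, ∀ i, φ.Realize (Sum.elim a (b (η i)))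

/-- `T = Th(𝕄)` has `k`-`DCTP₂`: paths are `k`-inconsistent but descending
combs are consistent. -/
def HasKDCTP2 (L : FirstOrder.Language.{u, u}) (𝕄 : Type u) [L.Structure 𝕄] (k : ℕ) : Prop :=
  ∃ (r m : ℕ) (φ : L.Formula (Fin r ⊕ Fin m)) (b : List Bool → Fin m → 𝕄),
    (∀ σ : ℕ → Bool, ∀ s : Finset ℕ, s.card = k →
      ¬ ∃ a : Fin r → 𝕄, ∀ n ∈ s,
        φ.Realize (Sum.elim a (b (List.ofFn fun i : Fin n => σ i)))) ∧
    ∀ (l : ℕ) (η : Fin l → List Bool), DescendingComb η →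
      ∃ a : Fin r → 𝕄, ∀ i, φ.Realize (Sum.elim a (b (η i)))

/-! ### Kim-dividing and Conant-dividing, with respect to coheir Morley sequences -/

/-- `φ(x, b)` Kim-divides over `Ms`: some coheir Morley sequence over `Ms`
starting with `b` makes it inconsistent. -/
def KimDivides (L : FirstOrder.Language.{u, u}) {𝕄 : Type u} [L.Structure 𝕄] (Ms : Set 𝕄)
    {α : Type v} {n : ℕ} (φ : L.Formula (α ⊕ Fin n)) (b : Fin n → 𝕄) : Prop :=
  ∃ B : ℕ → Fin n → 𝕄, CoheirMorley L Ms B ∧ B 0 = b ∧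
    ¬ ∃ a : α → 𝕄, ∀ i, φ.Realize (Sum.elim a (B i))

/-- `φ(x, b)` Kim-forks over `Ms`: it implies a finite disjunction of formulas
Kim-dividing over `Ms`. -/
def KimForks (L : FirstOrder.Language.{u, u}) {𝕄 : Type u} [L.Structure 𝕄] (Ms : Set 𝕄)
    {α : Type v} {n : ℕ} (φ : L.Formula (α ⊕ Fin n)) (b : Fin n → 𝕄) : Prop :=
  ∃ (N : ℕ) (m : Fin N → ℕ) (ψ : ∀ j : Fin N, L.Formula (α ⊕ Fin (m j)))
    (c : ∀ j : Fin N, Fin (m j) → 𝕄),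
    (∀ j, KimDivides L Ms (ψ j) (c j)) ∧
    ∀ a : α → 𝕄, φ.Realize (Sum.elim a b) → ∃ j, (ψ j).Realize (Sum.elim a (c j))

/-- `φ(x, b)` Conant-divides over `Ms`: every coheir Morley sequence over `Ms`
starting with `b` makes it inconsistent. -/
def ConantDivides (L : FirstOrder.Language.{u, u}) {𝕄 : Type u} [L.Structure 𝕄] (Ms : Set 𝕄)
    {α : Type v} {n : ℕ} (φ : L.Formula (α ⊕ Fin n)) (b : Fin n → 𝕄) : Prop :=
  ∀ B : ℕ → Fin n → 𝕄, CoheirMorley L Ms B → B 0 = b →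
    ¬ ∃ a : α → 𝕄, ∀ i, φ.Realize (Sum.elim a (B i))

/-- `φ(x, b)` Conant-forks over `Ms`. -/
def ConantForks (L : FirstOrder.Language.{u, u}) {𝕄 : Type u} [L.Structure 𝕄] (Ms : Set 𝕄)
    {α : Type v} {n : ℕ} (φ : L.Formula (α ⊕ Fin n)) (b : Fin n → 𝕄) : Prop :=
  ∃ (N : ℕ) (m : Fin N → ℕ) (ψ : ∀ j : Fin N, L.Formula (α ⊕ Fin (m j)))
    (c : ∀ j : Fin N, Fin (m j) → 𝕄),
    (∀ j, ConantDivides L Ms (ψ j) (c j)) ∧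
    ∀ a : α → 𝕄, φ.Realize (Sum.elim a b) → ∃ j, (ψ j).Realize (Sum.elim a (c j))

/-- `a ⫝^{K*}_{Ms} b` : `tp(a/Ms b)` contains no formula Conant-forking
over `Ms`. -/
def ConantIndep (L : FirstOrder.Language.{u, u}) {𝕄 : Type u} [L.Structure 𝕄] (Ms : Set 𝕄)
    {α : Type v} {β : Type w} (a : α → 𝕄) (b : β → 𝕄) : Prop :=
  ∀ (n : ℕ) (φ : L.Formula (α ⊕ Fin n)) (d : Fin n → 𝕄),
    (∀ i, d i ∈ Ms ∪ Set.range b) → φ.Realize (Sum.elim a d) →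
    ¬ ConantForks L Ms φ d

/-! ### Abstract independence relations between sets over models -/

/-- An abstract ternary relation `A ⫝_M B` between subsets of `𝕄` over
(elementary submodels of) `𝕄`. -/
structure IndRel (L : FirstOrder.Language.{u, u}) (𝕄 : Type u) [L.Structure 𝕄] where
  rel : Set 𝕄 → Set 𝕄 → Set 𝕄 → Prop

/-- A set `S` of `α`-tuples is type-definable over `C`. -/
def TypeDefinableOver (L : FirstOrder.Language.{u, u}) {𝕄 : Type u} [L.Structure 𝕄] (C : Set 𝕄)
    {γ : Type v} (S : Set (γ → 𝕄)) : Prop :=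
  ∃ Γ : Set (FmlP L 𝕄 γ), (∀ p ∈ Γ, ∀ i, p.2.2 i ∈ C) ∧
    ∀ g : γ → 𝕄, g ∈ S ↔ ∀ p ∈ Γ, p.2.1.Realize (Sum.elim g p.2.2)

namespace IndRel


/-- Invariance under automorphisms of `𝕄`. -/
def Invariant (R : IndRel L 𝕄) : Prop :=
  ∀ (σ : 𝕄 ≃[L] 𝕄) (A Ms B : Set 𝕄), R.rel A Ms B →
    R.rel ((⇑σ) '' A) ((⇑σ) '' Ms) ((⇑σ) '' B)

/-- Monotonicity (on both sides). -/
def Mono (R : IndRel L 𝕄) : Prop :=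
  ∀ (A A' Ms B B' : Set 𝕄), IsElemSubmodel L Ms → R.rel A Ms B →
    Ms ⊆ A' → A' ⊆ A → Ms ⊆ B' → B' ⊆ B → R.rel A' Ms B'

/-- Existence: for `M ⊆ A, B` there is `A' ≡_M A` with `A' ⫝_M B`. -/
def Existence (R : IndRel L 𝕄) (κ : Cardinal.{u}) : Prop :=
  ∀ (Ms : Set 𝕄), IsElemSubmodel L Ms → Cardinal.mk Ms < κ →
    ∀ (α β : Type u), Cardinal.mk α < κ → Cardinal.mk β < κ →
      ∀ (a : α → 𝕄) (b : β → 𝕄),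
        ∃ a' : α → 𝕄, EqTpOver L Ms a' a ∧
          R.rel (Ms ∪ Set.range a') Ms (Ms ∪ Set.range b)

/-- Right extension. -/
def RightExt (R : IndRel L 𝕄) (κ : Cardinal.{u}) : Prop :=
  ∀ (Ms : Set 𝕄), IsElemSubmodel L Ms → Cardinal.mk Ms < κ →
    ∀ (α : Type u), Cardinal.mk α < κ → ∀ (a : α → 𝕄) (B C : Set 𝕄),
      Cardinal.mk B < κ → Cardinal.mk C < κ →
      R.rel (Set.range a) Ms B → B ⊆ C →
      ∃ a' : α → 𝕄, EqTpOver L B a' a ∧ R.rel (Set.range a') Ms C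

/-- Quasi-strong finite character: for complete types `p = tp(a₀/Ms)` and
`q = tp(b₀/Ms)`, the set of pairs of realizations `(a, b)` with `a ⫝_Ms b`
is type-definable over `Ms`. -/
def QSFC (R : IndRel L 𝕄) (κ : Cardinal.{u}) : Prop :=
  ∀ (Ms : Set 𝕄), IsElemSubmodel L Ms → Cardinal.mk Ms < κ →
    ∀ (α β : Type u), Cardinal.mk α < κ → Cardinal.mk β < κ →
      ∀ (a₀ : α → 𝕄) (b₀ : β → 𝕄),
        TypeDefinableOver L Ms {g : (α ⊕ β) → 𝕄 |
          EqTpOver L Ms (g ∘ Sum.inl) a₀ ∧ EqTpOver L Ms (g ∘ Sum.inr) b₀ ∧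
          R.rel (Set.range (g ∘ Sum.inl)) Ms (Set.range (g ∘ Sum.inr))}

/-- The coheir chain condition. -/
def CoheirChain (R : IndRel L 𝕄) (κ : Cardinal.{u}) : Prop :=
  ∀ (Ms : Set 𝕄), IsElemSubmodel L Ms → Cardinal.mk Ms < κ →
    ∀ (α β : Type u), Cardinal.mk α < κ → Cardinal.mk β < κ →
      ∀ (a : α → 𝕄) (b : β → 𝕄), R.rel (Set.range a) Ms (Set.range b) →
        ∀ I : ℕ → β → 𝕄, CoheirMorley L Ms I → I 0 = b →
          ∃ I' : ℕ → β → 𝕄, EqTpOver L Ms (flatSeq I') (flatSeq I) ∧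
            R.rel (Set.range a) Ms (⋃ i, Set.range (I' i)) ∧
            ∀ i, EqTpOver L (Ms ∪ Set.range a) (I' i) b

/-- `R` implies `⫝ʰ` : `A ⫝_M B` implies `tp(B / M A)` is finitely
satisfiable in `M`. -/
def StrongerThanH (R : IndRel L 𝕄) : Prop :=
  ∀ (A Ms B : Set 𝕄), IsElemSubmodel L Ms → R.rel A Ms B →
    FinSatIn L Ms (fun x : B => (x : 𝕄)) (Ms ∪ A)

end IndRel

/-- The axioms satisfied by the relations among which `⫝^CK` is weakest. -/
def GoodRel (R : IndRel L 𝕄) (κ : Cardinal.{u}) : Prop :=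
  R.StrongerThanH ∧ R.Invariant ∧ R.Mono ∧ R.Existence κ ∧ R.RightExt κ ∧ R.CoheirChain κ

/-- `R` is `⫝^CK` : the weakest relation implying `⫝ʰ` and satisfying
invariance, monotonicity, existence, right extension and the coheir chain
condition. -/
def IsCK (R : IndRel L 𝕄) (κ : Cardinal.{u}) : Prop :=
  GoodRel R κ ∧ ∀ R' : IndRel L 𝕄, GoodRel R' κ →
    ∀ A Ms B : Set 𝕄, R'.rel A Ms B → R.rel A Ms B

/-- `q` is a canonical global type over `Ms` (w.r.t. the relation `R = ⫝^CK`):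
whenever `c ⊨ q|_{Ms b}` we have `b ⫝^CK_{Ms} c`. -/
def IsCanonicalGlobal (R : IndRel L 𝕄) (κ : Cardinal.{u}) (Ms : Set 𝕄) {α : Type v}
    (q : GlobalType L 𝕄 α) : Prop :=
  ∀ (β : Type u), Cardinal.mk β < κ → ∀ (b : β → 𝕄) (c : α → 𝕄),
    RealizesType q c (Ms ∪ Set.range b) → R.rel (Set.range b) Ms (Set.range c)

/-- A canonical Morley sequence over `Ms`: a coheir Morley sequence in a
canonical coheir. -/
def CanonicalMorley (R : IndRel L 𝕄) (κ : Cardinal.{u}) (Ms : Set 𝕄) {α : Type v}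
    (I : ℕ → α → 𝕄) : Prop :=
  ∃ q : GlobalType L 𝕄 α, IsCanonicalGlobal R κ Ms q ∧ MorleyIn q Ms I

/-- `q` is a strong canonical global type over `Ms`. -/
def IsStrongCanonical (R : IndRel L 𝕄) (κ : Cardinal.{u}) (Ms : Set 𝕄) {α : Type v}
    (q : GlobalType L 𝕄 α) : Prop :=
  ∀ (β : Type u), Cardinal.mk β < κ → ∀ (b : β → 𝕄) (c : α → 𝕄),
    RealizesType q c (Ms ∪ Set.range b) →
    ∀ (γ : Type u), Cardinal.mk γ < κ → ∀ (a : γ → 𝕄),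
      ∃ a' : γ → 𝕄, EqTpOver L (Ms ∪ Set.range c) a' a ∧
        ∃ q' : GlobalType L 𝕄 (γ ⊕ α), IsCanonicalGlobal R κ Ms q' ∧
          ExtendsTpOver q' (Ms ∪ Set.range b) (Sum.elim a' c)

/-! ### `M`-invariant ideals and `𝓘`-Kim-dividing -/

/-- An `Ms`-invariant ideal on the definable subsets of `𝕄` (in variables `α`). -/
structure InvIdeal (L : FirstOrder.Language.{u, u}) (𝕄 : Type u) [L.Structure 𝕄] (Ms : Set 𝕄)
    (α : Type v) where
  mem : Set (α → 𝕄) → Prop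
  definable_of_mem : ∀ S, mem S → ∃ (n : ℕ) (ψ : L.Formula (α ⊕ Fin n)) (c : Fin n → 𝕄),
    S = {a : α → 𝕄 | ψ.Realize (Sum.elim a c)}
  union_mem : ∀ S T, mem S → mem T → mem (S ∪ T)
  subset_mem : ∀ S T, mem S →
    (∃ (n : ℕ) (ψ : L.Formula (α ⊕ Fin n)) (c : Fin n → 𝕄),
      T = {a : α → 𝕄 | ψ.Realize (Sum.elim a c)}) →
    T ⊆ S → mem T
  invariant : ∀ σ : 𝕄 ≃[L] 𝕄, (∀ x ∈ Ms, σ x = x) → ∀ S, mem S →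
    mem ((fun a => (⇑σ) ∘ a) '' S)

/-- `φ(x, b)` `𝓘`-Kim-divides over `Ms`. -/
def IKimDivides {Ms : Set 𝕄} {α : Type v} (I : InvIdeal L 𝕄 Ms α) {n : ℕ}
    (φ : L.Formula (α ⊕ Fin n)) (b : Fin n → 𝕄) : Prop :=
  ∃ (B : ℕ → Fin n → 𝕄) (k : ℕ), CoheirMorley L Ms B ∧ B 0 = b ∧ 0 < k ∧
    ∀ s : Finset ℕ, s.card = k →
      I.mem {a : α → 𝕄 | ∀ i ∈ s, φ.Realize (Sum.elim a (B i))}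

/-- `φ(x, b)` `𝓘`-Kim-forks over `Ms`. -/
def IKimForks {Ms : Set 𝕄} {α : Type v} (I : InvIdeal L 𝕄 Ms α) {n : ℕ}
    (φ : L.Formula (α ⊕ Fin n)) (b : Fin n → 𝕄) : Prop :=
  ∃ (N : ℕ) (m : Fin N → ℕ) (ψ : ∀ j : Fin N, L.Formula (α ⊕ Fin (m j)))
    (c : ∀ j : Fin N, Fin (m j) → 𝕄),
    (∀ j, IKimDivides I (ψ j) (c j)) ∧
    ∀ a : α → 𝕄, φ.Realize (Sum.elim a b) → ∃ j, (ψ j).Realize (Sum.elim a (c j))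

/-- `φ(x, b)` `𝓘`-quasi-divides over `Ms`. -/
def IQuasiDivides {Ms : Set 𝕄} {α : Type v} (I : InvIdeal L 𝕄 Ms α) {n : ℕ}
    (φ : L.Formula (α ⊕ Fin n)) (b : Fin n → 𝕄) : Prop :=
  ∃ (mm : ℕ) (b' : Fin mm → Fin n → 𝕄), 0 < mm ∧ (∀ j, EqTpOver L Ms (b' j) b) ∧
    I.mem {a : α → 𝕄 | ∀ j, φ.Realize (Sum.elim a (b' j))}

/-! ### `h^⫝`-inconsistency and the derived relation `⫝'` -/

/-- A family of formulas is `h^⫝`-inconsistent with respect to `P = tp(a₀/Ms)`. -/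
def HInconsistent (R : IndRel L 𝕄) (Ms : Set 𝕄) {α : Type v} (a₀ : α → 𝕄)
    {ι : Type w} (m : ι → ℕ) (φ : ∀ i : ι, L.Formula (α ⊕ Fin (m i)))
    (b : ∀ i : ι, Fin (m i) → 𝕄) : Prop :=
  ¬ ∃ a : α → 𝕄, EqTpOver L Ms a a₀ ∧
      R.rel (Set.range a) Ms (⋃ i, Set.range (b i)) ∧
      ∀ i, (φ i).Realize (Sum.elim a (b i))

/-- A single formula is `h^⫝`-inconsistent with respect to `P = tp(a₀/Ms)`. -/
def HInconsistentSingle (R : IndRel L 𝕄) (Ms : Set 𝕄) {α : Type v} (a₀ : α → 𝕄)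
    {n : ℕ} (φ : L.Formula (α ⊕ Fin n)) (b : Fin n → 𝕄) : Prop :=
  ¬ ∃ a : α → 𝕄, EqTpOver L Ms a a₀ ∧ R.rel (Set.range a) Ms (Set.range b) ∧
      φ.Realize (Sum.elim a b)

/-- `φ(x, b)` `h^⫝`-Kim-divides with respect to `tp(a₀/Ms)`. -/
def HKimDivides (R : IndRel L 𝕄) (Ms : Set 𝕄) {α : Type v} (a₀ : α → 𝕄)
    {n : ℕ} (φ : L.Formula (α ⊕ Fin n)) (b : Fin n → 𝕄) : Prop :=
  ∃ B : ℕ → Fin n → 𝕄, CoheirMorley L Ms B ∧ B 0 = b ∧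
    HInconsistent R Ms a₀ (fun _ : ℕ => n) (fun _ => φ) B

/-- `φ(x, b)` `h^⫝`-Kim-forks with respect to `tp(a₀/Ms)`. -/
def HKimForks (R : IndRel L 𝕄) (Ms : Set 𝕄) {α : Type v} (a₀ : α → 𝕄)
    {n : ℕ} (φ : L.Formula (α ⊕ Fin n)) (b : Fin n → 𝕄) : Prop :=
  ∃ (N : ℕ) (m : Fin N → ℕ) (ψ : ∀ j : Fin N, L.Formula (α ⊕ Fin (m j)))
    (c : ∀ j : Fin N, Fin (m j) → 𝕄),
    (∀ j, HKimDivides R Ms a₀ (ψ j) (c j)) ∧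
    ∀ a : α → 𝕄, φ.Realize (Sum.elim a b) → ∃ j, (ψ j).Realize (Sum.elim a (c j))

/-- `φ(x, b)` `h^⫝`-quasi-divides with respect to `tp(a₀/Ms)`. -/
def HQuasiDivides (R : IndRel L 𝕄) (Ms : Set 𝕄) {α : Type v} (a₀ : α → 𝕄)
    {n : ℕ} (φ : L.Formula (α ⊕ Fin n)) (b : Fin n → 𝕄) : Prop :=
  ∃ (mm : ℕ) (b' : Fin mm → Fin n → 𝕄), 0 < mm ∧ (∀ j, EqTpOver L Ms (b' j) b) ∧
    HInconsistent R Ms a₀ (fun _ : Fin mm => n) (fun _ => φ) b'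

/-- The derived relation `⫝'` on tuples:
`tp(a / Ms b)` contains no formula `h^⫝`-Kim-forking w.r.t. `tp(a/Ms)`. -/
def DerivedIndep (R : IndRel L 𝕄) (Ms : Set 𝕄) {α : Type v} {β : Type w}
    (a : α → 𝕄) (b : β → 𝕄) : Prop :=
  ∀ (n : ℕ) (φ : L.Formula (α ⊕ Fin n)) (d : Fin n → 𝕄),
    (∀ i, d i ∈ Ms ∪ Set.range b) → φ.Realize (Sum.elim a d) →
    ¬ HKimForks R Ms a φ d

/-- The derived relation `⫝'` as a relation between sets over models. -/
def derived (R : IndRel L 𝕄) : IndRel L 𝕄 where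
  rel A Ms B := ∀ (n : ℕ) (φ : L.Formula (↥A ⊕ Fin n)) (d : Fin n → 𝕄),
    (∀ i, d i ∈ Ms ∪ B) → φ.Realize (Sum.elim (fun x : A => (x : 𝕄)) d) →
    ¬ HKimForks R Ms (fun x : A => (x : 𝕄)) φ d

/-! ### Coheir trees -/

/-- The tuple, indexed by extensions, consisting of the part of the tree `c`
lying (weakly) above the node `ν` (where `ν` has length `Lh`). -/
def subtreeTupleLen {α : Type v} {n : ℕ} (c : {l : List ℕ // l.length ≤ n} → α → 𝕄)
    (Lh : ℕ) (ν : List ℕ) (hν : ν.length = Lh) :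
    ({s : List ℕ // Lh + s.length ≤ n} × α) → 𝕄 :=
  fun p => c ⟨ν ++ p.1.1, by rw [List.length_append, hν]; exact p.1.2⟩ p.2

end NSOP2Paper

namespace NSOP2Paper

section Definability

variable {L : FirstOrder.Language.{u, u}} {𝕄 : Type u} [L.Structure 𝕄]

/-- Only finitely many of the variables in `γ` occur in a formula. -/
theorem exists_formula_fin {α γ : Type*} (φ : L.Formula (α ⊕ γ)) :
    ∃ (n : ℕ) (ψ : L.Formula (α ⊕ Fin n)) (f : Fin n → γ), Function.Injective f ∧
      ∀ (x : α → 𝕄) (c : γ → 𝕄),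
        φ.Realize (Sum.elim x c) ↔ ψ.Realize (Sum.elim x (c ∘ f)) := by
  classical
  let s : Finset γ := φ.freeVarFinset.toRight
  let e : s ≃ Fin s.card := s.equivFin
  let g : φ.freeVarFinset → α ⊕ Fin s.card := fun v =>
    match v with
    | ⟨Sum.inl a, _⟩ => Sum.inl a
    | ⟨Sum.inr c, h⟩ => Sum.inr (e ⟨c, Finset.mem_toRight.2 h⟩)
  refine ⟨s.card, φ.restrictFreeVar g, fun i => (e.symm i : γ),
    Subtype.val_injective.comp e.symm.injective, fun x c => ?_⟩
  refine (BoundedFormula.realize_restrictFreeVar (Sum.elim x c) ?_).symm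
  rintro ⟨a | b, h⟩ <;> simp [g]

/-- Definable sets are closed under substituting variables and parameters for variables. -/
theorem Definable.subst {α ι : Type*} {C : Set 𝕄} {T : Set (ι → 𝕄)} (hT : C.Definable L T)
    (h : (α → 𝕄) → ι → 𝕄)
    (hh : ∀ i, (∃ j, ∀ x, h x i = x j) ∨ ∃ m ∈ C, ∀ x, h x i = m) :
    C.Definable L {x | h x ∈ T} := by
  rw [Set.definable_iff_exists_formula_sum] at hT ⊢
  obtain ⟨φ, rfl⟩ := hT
  have hg : ∀ i, ∃ v : C ⊕ α, ∀ x, h x i = Sum.elim (fun m : C => (m : 𝕄)) x v := by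
    intro i
    rcases hh i with ⟨j, hj⟩ | ⟨m, hm, hj⟩
    · exact ⟨Sum.inr j, hj⟩
    · exact ⟨Sum.inl ⟨m, hm⟩, hj⟩
  choose g hg using hg
  refine ⟨φ.relabel (Sum.elim Sum.inl g), ?_⟩
  ext x
  simp only [Set.mem_ofPred_eq, Formula.realize_relabel]
  rw [iff_iff_eq]
  congr 1
  ext v
  rcases v with m | i
  · rfl
  · exact hg i x

theorem definable_slice {α γ : Type*} {C : Set 𝕄} {T : Set (α ⊕ γ → 𝕄)}
    (hT : C.Definable L T) {c : γ → 𝕄} (hc : ∀ j, c j ∈ C) :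
    C.Definable L {x | Sum.elim x c ∈ T} := by
  refine Definable.subst hT (fun x => Sum.elim x c) ?_
  rintro (a | j)
  · exact Or.inl ⟨a, fun _ => rfl⟩
  · exact Or.inr ⟨c j, hc j, fun _ => rfl⟩

theorem definable_slice_left {α γ : Type*} {C : Set 𝕄} {T : Set (α ⊕ γ → 𝕄)}
    (hT : C.Definable L T) {a : α → 𝕄} (ha : ∀ j, a j ∈ C) :
    C.Definable L {y | Sum.elim a y ∈ T} := by
  refine Definable.subst hT (fun y => Sum.elim a y) ?_
  rintro (j | j)
  · exact Or.inr ⟨a j, ha j, fun _ => rfl⟩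
  · exact Or.inl ⟨j, fun _ => rfl⟩

theorem definable_relabel {α ι : Type*} {C : Set 𝕄} {T : Set (ι → 𝕄)}
    (hT : C.Definable L T) (f : ι → α) : C.Definable L {x : α → 𝕄 | x ∘ f ∈ T} :=
  Definable.subst hT (fun x => x ∘ f) fun i => Or.inl ⟨f i, fun _ => rfl⟩

/-- A set definable over `C` together with a tuple `c` is the fibre over `c` of a
`C`-definable set. -/
theorem exists_slice {α γ : Type*} {C : Set 𝕄} {c : γ → 𝕄} {S : Set (α → 𝕄)}
    (hS : (C ∪ Set.range c).Definable L S) :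
    ∃ T : Set (α ⊕ γ → 𝕄), C.Definable L T ∧ S = {x | Sum.elim x c ∈ T} := by
  rw [Set.definable_iff_exists_formula_sum] at hS
  obtain ⟨φ, rfl⟩ := hS
  have hg : ∀ p : ↥(C ∪ Set.range c), ∃ v : C ⊕ (α ⊕ γ),
      ∀ x : α → 𝕄, Sum.elim (fun m : C => (m : 𝕄)) (Sum.elim x c) v = p := by
    rintro ⟨p, hp | ⟨j, rfl⟩⟩
    · exact ⟨Sum.inl ⟨p, hp⟩, fun _ => rfl⟩
    · exact ⟨Sum.inr (Sum.inr j), fun _ => rfl⟩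
  choose g hg using hg
  refine ⟨_, Set.definable_iff_exists_formula_sum.2
    ⟨φ.relabel (Sum.elim g (fun a => Sum.inr (Sum.inl a))), rfl⟩, ?_⟩
  ext x
  simp only [Set.mem_ofPred_eq, Formula.realize_relabel]
  rw [iff_iff_eq]
  congr 1
  ext v
  rcases v with m | i
  · exact (hg m x).symm
  · rfl

theorem definable_iff_exists_fin {α : Type*} {C : Set 𝕄} {S : Set (α → 𝕄)} :
    C.Definable L S ↔ ∃ (n : ℕ) (φ : L.Formula (α ⊕ Fin n)) (c : Fin n → 𝕄),
      (∀ i, c i ∈ C) ∧ S = {x | φ.Realize (Sum.elim x c)} := by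
  constructor
  · intro h
    rw [Set.definable_iff_exists_formula_sum] at h
    obtain ⟨φ, rfl⟩ := h
    obtain ⟨n, ψ, f, -, hψ⟩ := exists_formula_fin (𝕄 := 𝕄) (φ.relabel Sum.swap)
    refine ⟨n, ψ, fun i => f i, fun i => (f i).2, ?_⟩
    ext x
    have := hψ x (fun m : C => (m : 𝕄))
    rw [Formula.realize_relabel] at this
    simp only [Set.mem_ofPred_eq]
    refine Iff.trans ?_ this
    rw [iff_iff_eq]
    congr 1
    ext v
    rcases v with m | i <;> rfl
  · rintro ⟨n, φ, c, hc, rfl⟩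
    refine definable_slice (T := {v | φ.Realize v}) ?_ hc
    rw [Set.definable_iff_exists_formula_sum]
    exact ⟨φ.relabel Sum.inr, by ext; simp [Formula.realize_relabel, Function.comp_def]⟩

theorem definable_exists {α γ : Type*} {C : Set 𝕄} {T : Set (α ⊕ γ → 𝕄)}
    (hT : C.Definable L T) : C.Definable L {x : α → 𝕄 | ∃ z : γ → 𝕄, Sum.elim x z ∈ T} := by
  rcases isEmpty_or_nonempty 𝕄 with h𝕄 | h𝕄
  · have : Subsingleton (α → 𝕄) := ⟨fun x y => funext fun i => (h𝕄.false (x i)).elim⟩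
    rcases (Set.subsingleton_of_subsingleton
      (s := {x : α → 𝕄 | ∃ z : γ → 𝕄, Sum.elim x z ∈ T})).eq_empty_or_singleton with h | ⟨x, h⟩
    · rw [h]; exact Set.definable_empty
    · rw [h, show ({x} : Set (α → 𝕄)) = Set.univ from
        Set.eq_univ_of_forall fun y => Subsingleton.elim _ _]
      exact Set.definable_univ
  rw [Set.definable_iff_exists_formula_sum] at hT ⊢
  obtain ⟨φ, rfl⟩ := hT
  obtain ⟨n, ψ, f, hf, hψ⟩ := exists_formula_fin (𝕄 := 𝕄)
    (φ.relabel (Equiv.sumAssoc C α γ).symm)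
  refine ⟨ψ.iExs (Fin n), ?_⟩
  have key : ∀ (x : α → 𝕄) (z : γ → 𝕄), φ.Realize (Sum.elim (fun m : C => (m : 𝕄)) (Sum.elim x z)) ↔
      ψ.Realize (Sum.elim (Sum.elim (fun m : C => (m : 𝕄)) x) (z ∘ f)) := by
    intro x z
    rw [← hψ, Formula.realize_relabel, iff_iff_eq]
    congr 1
    ext v
    rcases v with m | i | j <;> rfl
  ext x
  simp only [Set.mem_ofPred_eq, Formula.realize_iExs]
  constructor
  · rintro ⟨z, hz⟩
    exact ⟨z ∘ f, (key x z).1 hz⟩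
  · rintro ⟨y, hy⟩
    refine ⟨Function.extend f y fun _ => Classical.arbitrary 𝕄, (key x _).2 ?_⟩
    rwa [show Function.extend f y (fun _ => Classical.arbitrary 𝕄) ∘ f = y from
      funext fun i => hf.extend_apply _ _ _]

theorem IsElemSubmodel.nonempty {M : Set 𝕄} (hM : IsElemSubmodel L M) [Nonempty 𝕄] :
    M.Nonempty := by
  obtain ⟨S, rfl⟩ := hM
  have : Nonempty S := S.elementarilyEquivalent.symm.nonempty
  obtain ⟨x⟩ := this
  exact ⟨x, x.2⟩

/-- The Tarski-Vaught property, for sets of tuples of arbitrary length. -/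
theorem IsElemSubmodel.exists_mem {M : Set 𝕄} (hM : IsElemSubmodel L M) {γ : Type*}
    {T : Set (γ → 𝕄)} (hT : M.Definable L T) (hne : T.Nonempty) : ∃ x ∈ T, ∀ i, x i ∈ M := by
  obtain ⟨z, hz⟩ := hne
  rcases isEmpty_or_nonempty 𝕄 with h𝕄 | h𝕄
  · exact ⟨z, hz, fun i => (h𝕄.false (z i)).elim⟩
  obtain ⟨m₀, hm₀⟩ := hM.nonempty
  obtain ⟨S, rfl⟩ := hM
  rw [Set.definable_iff_exists_formula_sum] at hT
  obtain ⟨φ, rfl⟩ := hT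
  obtain ⟨n, ψ, f, hf, hψ⟩ := exists_formula_fin (𝕄 := 𝕄) φ
  have h1 : (ψ.iExs (Fin n)).Realize (fun m : S => (m : 𝕄)) := by
    rw [Formula.realize_iExs]
    exact ⟨z ∘ f, (hψ _ _).1 hz⟩
  have h2 : (ψ.iExs (Fin n)).Realize (id : S → S) := by
    rw [← S.subtype.map_formula]
    exact h1
  rw [Formula.realize_iExs] at h2
  obtain ⟨y, hy⟩ := h2
  rw [← S.subtype.map_formula] at hy
  refine ⟨Function.extend f (fun i => (y i : 𝕄)) fun _ => m₀, (hψ _ _).2 ?_, fun i => ?_⟩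
  · rw [show Function.extend f (fun i => (y i : 𝕄)) (fun _ => m₀) ∘ f = fun i => (y i : 𝕄) from
      funext fun i => hf.extend_apply _ _ _]
    convert hy using 1
    ext v
    rcases v with m | i <;> rfl
  · by_cases hi : ∃ j, f j = i
    · obtain ⟨j, rfl⟩ := hi
      rw [hf.extend_apply]
      exact (y j).2
    · rw [Function.extend_apply' _ _ _ hi]
      exact hm₀

/-- Pulling back a definable set along an automorphism. -/
theorem definable_preimage_equiv {α : Type*} {C : Set 𝕄} (σ : 𝕄 ≃[L] 𝕄) {S : Set (α → 𝕄)}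
    (hS : (σ '' C).Definable L S) : C.Definable L {x | ⇑σ ∘ x ∈ S} := by
  rw [definable_iff_exists_fin] at hS ⊢
  obtain ⟨n, φ, c, hc, rfl⟩ := hS
  choose d hd using hc
  refine ⟨n, φ, d, fun i => (hd i).1, ?_⟩
  ext x
  simp only [Set.mem_ofPred_eq]
  rw [← StrongHomClass.realize_formula σ φ (v := Sum.elim x d), iff_iff_eq]
  congr 1
  ext v
  rcases v with m | i
  · rfl
  · exact (hd i).2.symm

theorem comp_mem_iff_of_fixes {α : Type*} {C : Set 𝕄} {σ : 𝕄 ≃[L] 𝕄} (hσ : ∀ m ∈ C, σ m = m)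
    {S : Set (α → 𝕄)} (hS : C.Definable L S) (x : α → 𝕄) : ⇑σ ∘ x ∈ S ↔ x ∈ S := by
  rw [definable_iff_exists_fin] at hS
  obtain ⟨n, φ, c, hc, rfl⟩ := hS
  simp only [Set.mem_ofPred_eq]
  rw [← StrongHomClass.realize_formula σ φ (v := Sum.elim x c), iff_iff_eq]
  congr 1
  ext v
  rcases v with m | i
  · rfl
  · exact (hσ _ (hc i)).symm

end Definability

section Types

variable {L : FirstOrder.Language.{u, u}} {𝕄 : Type u} [L.Structure 𝕄] {κ : Cardinal.{u}}

/-- Equality of types over `C`, phrased with definable sets. -/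
def SameType (L : FirstOrder.Language.{u, u}) {𝕄 : Type u} [L.Structure 𝕄] (C : Set 𝕄)
    {α : Type v} (a b : α → 𝕄) : Prop :=
  ∀ S : Set (α → 𝕄), C.Definable L S → (a ∈ S ↔ b ∈ S)

theorem sameType_iff_eqTpOver {α : Type v} {C : Set 𝕄} {a b : α → 𝕄} :
    SameType L C a b ↔ EqTpOver L C a b := by
  constructor
  · intro h n φ c hc
    exact h _ (definable_iff_exists_fin.2 ⟨n, φ, c, hc, rfl⟩)
  · intro h S hS
    obtain ⟨n, φ, c, hc, rfl⟩ := definable_iff_exists_fin.1 hS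
    exact h n φ c hc

namespace SameType

variable {α : Type v} {ι : Type w} {C D : Set 𝕄} {a b d : α → 𝕄}

theorem symm (h : SameType L C a b) : SameType L C b a := fun S hS => (h S hS).symm

theorem mono (h : SameType L D a b) (hCD : C ⊆ D) : SameType L C a b :=
  fun S hS => h S (hS.mono hCD)

theorem comp (h : SameType L C a b) (f : ι → α) : SameType L C (a ∘ f) (b ∘ f) :=
  fun _ hS => h _ (definable_relabel hS f)

theorem of_imp (h : ∀ S, C.Definable L S → a ∈ S → b ∈ S) : SameType L C a b :=
  fun S hS => ⟨h S hS, fun hb => by_contra fun ha => h _ hS.compl ha hb⟩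

theorem of_fixes {σ : 𝕄 ≃[L] 𝕄} (hσ : ∀ m ∈ C, σ m = m) (a : α → 𝕄) :
    SameType L C (⇑σ ∘ a) a :=
  fun _ hS => comp_mem_iff_of_fixes hσ hS a

theorem of_sum_elim {x y : ι → 𝕄} (h : SameType L C (Sum.elim a x) (Sum.elim a y)) :
    SameType L (C ∪ Set.range a) x y := by
  intro S hS
  obtain ⟨T, hT, rfl⟩ := exists_slice hS
  have hswap : ∀ z : ι → 𝕄, Sum.elim a z ∘ Sum.swap = Sum.elim z a := fun z => by
    ext (i | i) <;> rfl
  have := h _ (definable_relabel hT Sum.swap)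
  simpa only [Set.mem_ofPred_eq, hswap] using this

end SameType

theorem exists_realization (hsat : IsSaturated L 𝕄 κ) {α : Type u} (hα : Cardinal.mk α < κ)
    {C : Set 𝕄} (hC : Cardinal.mk C < κ) (ℱ : Filter (α → 𝕄)) [ℱ.NeBot] :
    ∃ a : α → 𝕄, ∀ S ∈ ℱ, C.Definable L S → a ∈ S := by
  obtain ⟨a, ha⟩ := hsat α C hα hC
    {p | (∀ i, p.2.2 i ∈ C) ∧ {x : α → 𝕄 | p.2.1.Realize (Sum.elim x p.2.2)} ∈ ℱ}
    (fun p hp => hp.1) (fun t ht => by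
      have := (Filter.biInter_finset_mem t).2 fun p hp => (ht hp).2
      obtain ⟨a, ha⟩ := ℱ.nonempty_of_mem this
      exact ⟨a, fun p hp => Set.mem_iInter₂.1 ha p hp⟩)
  refine ⟨a, fun S hS hSC => ?_⟩
  obtain ⟨n, φ, c, hc, rfl⟩ := definable_iff_exists_fin.1 hSC
  exact ha ⟨n, φ, c⟩ ⟨hc, hS⟩

theorem IsMonster.union_lt (hm : IsMonster L 𝕄 κ) {C D : Set 𝕄} (hC : Cardinal.mk C < κ)
    (hD : Cardinal.mk D < κ) : Cardinal.mk ↑(C ∪ D) < κ :=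
  (Cardinal.mk_union_le C D).trans_lt (Cardinal.add_lt_of_lt hm.1.le hC hD)

theorem IsMonster.sum_lt (hm : IsMonster L 𝕄 κ) {α β : Type u} (hα : Cardinal.mk α < κ)
    (hβ : Cardinal.mk β < κ) : Cardinal.mk (α ⊕ β) < κ := by
  rw [Cardinal.mk_sum, Cardinal.lift_id, Cardinal.lift_id]
  exact Cardinal.add_lt_of_lt hm.1.le hα hβ

theorem mk_range_lt {α : Type u} (hα : Cardinal.mk α < κ) (a : α → 𝕄) :
    Cardinal.mk (Set.range a) < κ :=
  Cardinal.mk_range_le.trans_lt hα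

theorem IsMonster.iUnion_range_lt (hm : IsMonster L 𝕄 κ) {β : Type u} (hβ : Cardinal.mk β < κ)
    (I : ℕ → β → 𝕄) : Cardinal.mk ↑(⋃ i, Set.range (I i)) < κ := by
  have h : (⋃ i, Set.range (I i)) ⊆ Set.range fun p : ULift.{u} ℕ × β => I p.1.down p.2 := by
    rintro x hx
    obtain ⟨i, j, rfl⟩ := Set.mem_iUnion.1 hx
    exact ⟨(⟨i⟩, j), rfl⟩
  refine (Cardinal.mk_le_mk_of_subset h).trans_lt (mk_range_lt ?_ _)
  rw [Cardinal.mk_prod, Cardinal.lift_id, Cardinal.lift_id]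
  exact Cardinal.mul_lt_of_lt hm.1.le (by simpa using hm.1) hβ

theorem IsMonster.exists_equiv (hm : IsMonster L 𝕄 κ) {α : Type u} (hα : Cardinal.mk α < κ)
    {C : Set 𝕄} (hC : Cardinal.mk C < κ) {a b : α → 𝕄} (h : SameType L C a b) :
    ∃ σ : 𝕄 ≃[L] 𝕄, (∀ m ∈ C, σ m = m) ∧ ⇑σ ∘ a = b := by
  have key : SameType L (∅ : Set 𝕄) (Sum.elim a fun m : C => (m : 𝕄))
      (Sum.elim b fun m : C => (m : 𝕄)) := fun S hS =>
    h _ (definable_slice (hS.mono (Set.empty_subset C)) fun m => m.2)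
  obtain ⟨σ, hσ⟩ := hm.2.2 _ (hm.sum_lt hα hC) _ _ (sameType_iff_eqTpOver.1 key)
  exact ⟨σ, fun m hm => hσ (Sum.inr ⟨m, hm⟩), funext fun i => hσ (Sum.inl i)⟩

end Types

section Coheirs

variable {L : FirstOrder.Language.{u, u}} {𝕄 : Type u} [L.Structure 𝕄] {κ : Cardinal.{u}}

/-- The type of `c` over `C`, as a filter. -/
def typeFilter (L : FirstOrder.Language.{u, u}) {𝕄 : Type u} [L.Structure 𝕄] (C : Set 𝕄)
    {α : Type v} (c : α → 𝕄) : Filter (α → 𝕄) where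
  sets := {S | ∃ D, C.Definable L D ∧ c ∈ D ∧ D ⊆ S}
  univ_sets := ⟨Set.univ, Set.definable_univ, trivial, Set.subset_univ _⟩
  sets_of_superset := fun ⟨D, h1, h2, h3⟩ h => ⟨D, h1, h2, h3.trans h⟩
  inter_sets := fun ⟨D, h1, h2, h3⟩ ⟨D', h1', h2', h3'⟩ =>
    ⟨D ∩ D', h1.inter h1', ⟨h2, h2'⟩, Set.inter_subset_inter h3 h3'⟩

/-- The tuples with all coordinates in `M`. -/
def tuplesIn (M : Set 𝕄) (α : Type v) : Set (α → 𝕄) := {x | ∀ i, x i ∈ M}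

/-- `tp(c / C)` is finitely satisfiable in `M`, phrased with definable sets. -/
def IsCoheir (L : FirstOrder.Language.{u, u}) {𝕄 : Type u} [L.Structure 𝕄] (M C : Set 𝕄)
    {α : Type v} (c : α → 𝕄) : Prop :=
  ∀ S : Set (α → 𝕄), C.Definable L S → c ∈ S → ∃ x ∈ S, ∀ i, x i ∈ M

/-- `c` realizes the restriction to `C` of the global type given by the ultrafilter `U`. -/
def RealizesUltra (L : FirstOrder.Language.{u, u}) {𝕄 : Type u} [L.Structure 𝕄] {α : Type v}
    (U : Ultrafilter (α → 𝕄)) (C : Set 𝕄) (c : α → 𝕄) : Prop :=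
  ∀ S : Set (α → 𝕄), C.Definable L S → S ∈ U → c ∈ S

theorem realizesUltra_of_le {α : Type v} {U : Ultrafilter (α → 𝕄)} {C : Set 𝕄} {c : α → 𝕄}
    (h : ↑U ≤ typeFilter L C c) : RealizesUltra L U C c := by
  intro S hS hSU
  by_contra hc
  exact Ultrafilter.compl_mem_iff_notMem.1 (h ⟨Sᶜ, hS.compl, hc, subset_rfl⟩) hSU

theorem IsCoheir.exists_ultrafilter {α : Type v} {M C : Set 𝕄} {c : α → 𝕄}
    (h : IsCoheir L M C c) :
    ∃ U : Ultrafilter (α → 𝕄), tuplesIn M α ∈ U ∧ RealizesUltra L U C c := by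
  have : (typeFilter L C c ⊓ Filter.principal (tuplesIn M α)).NeBot := by
    rw [Filter.inf_principal_neBot_iff]
    rintro S ⟨D, hD, hcD, hDS⟩
    obtain ⟨x, hx, hxM⟩ := h D hD hcD
    exact ⟨x, hDS hx, hxM⟩
  have hle := Ultrafilter.of_le (typeFilter L C c ⊓ Filter.principal (tuplesIn M α))
  exact ⟨Ultrafilter.of _, Filter.le_principal_iff.1 (hle.trans inf_le_right),
    realizesUltra_of_le (hle.trans inf_le_left)⟩

theorem IsCoheir.sum_elim {α : Type v} {β : Type w} {M C : Set 𝕄} (hMC : M ⊆ C) {b : α → 𝕄}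
    {c : β → 𝕄} (hb : IsCoheir L M C b) (hc : IsCoheir L M (C ∪ Set.range b) c) :
    IsCoheir L M C (Sum.elim b c) := by
  intro D hD hbc
  obtain ⟨y, hy, hyM⟩ := hc {y | Sum.elim b y ∈ D}
    (definable_slice_left (hD.mono Set.subset_union_left) fun j => Or.inr ⟨j, rfl⟩) hbc
  obtain ⟨x, hx, hxM⟩ := hb {x | Sum.elim x y ∈ D} (definable_slice hD fun j => hMC (hyM j)) hy
  exact ⟨Sum.elim x y, hx, by rintro (i | i); exacts [hxM i, hyM i]⟩

theorem IsCoheir.map {α : Type v} {M C : Set 𝕄} {c : α → 𝕄} (h : IsCoheir L M C c)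
    {σ : 𝕄 ≃[L] 𝕄} (hσ : ∀ m ∈ M, σ m = m) : IsCoheir L M (σ '' C) (⇑σ ∘ c) := by
  intro S hS hc
  obtain ⟨x, hx, hxM⟩ := h _ (definable_preimage_equiv σ hS) hc
  refine ⟨x, ?_, hxM⟩
  rwa [Set.mem_ofPred_eq, show ⇑σ ∘ x = x from funext fun i => hσ _ (hxM i)] at hx

namespace RealizesUltra

variable {α : Type v} {U : Ultrafilter (α → 𝕄)} {M C D : Set 𝕄} {c d : α → 𝕄}

theorem mem_iff (h : RealizesUltra L U C c) {S : Set (α → 𝕄)} (hS : C.Definable L S) :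
    c ∈ S ↔ S ∈ U :=
  ⟨fun hc => by_contra fun hSU => h _ hS.compl (Ultrafilter.compl_mem_iff_notMem.2 hSU) hc,
    h S hS⟩

theorem mono (h : RealizesUltra L U D c) (hCD : C ⊆ D) : RealizesUltra L U C c :=
  fun S hS => h S (hS.mono hCD)

theorem isCoheir (h : RealizesUltra L U C c) (hU : tuplesIn M α ∈ U) : IsCoheir L M C c := by
  intro S hS hc
  obtain ⟨x, hx, hxM⟩ := U.nonempty_of_mem (Filter.inter_mem ((h.mem_iff hS).1 hc) hU)
  exact ⟨x, hx, hxM⟩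

theorem sameType (hc : RealizesUltra L U C c) (hd : RealizesUltra L U C d) : SameType L C c d :=
  fun _ hS => (hc.mem_iff hS).trans (hd.mem_iff hS).symm

theorem map (h : RealizesUltra L U C c) (hU : tuplesIn M α ∈ U) {σ : 𝕄 ≃[L] 𝕄}
    (hσ : ∀ m ∈ M, σ m = m) : RealizesUltra L U (σ '' C) (⇑σ ∘ c) := by
  intro S hS hSU
  refine h _ (definable_preimage_equiv σ hS) ?_
  filter_upwards [hSU, hU] with x hx hxM
  rwa [show ⇑σ ∘ x = x from funext fun i => hσ _ (hxM i)]

theorem comp {ι : Type w} (h : RealizesUltra L U C c) (f : ι → α) :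
    RealizesUltra L (U.map (· ∘ f)) C (c ∘ f) :=
  fun _ hS hSU => h _ (definable_relabel hS f) hSU

/-- Invariance over `M` of ultrafilters concentrating on `M`. -/
theorem sameType_sum_elim {δ : Type w} {b b' : δ → 𝕄}
    (hc : RealizesUltra L U (M ∪ Set.range b) c) (hd : RealizesUltra L U (M ∪ Set.range b') d)
    (hU : tuplesIn M α ∈ U) (hb : SameType L M b b') :
    SameType L M (Sum.elim b c) (Sum.elim b' d) := by
  intro S hS
  have h1 := hc.mem_iff (S := {y | Sum.elim b y ∈ S})
    (definable_slice_left (hS.mono Set.subset_union_left) fun j => Or.inr ⟨j, rfl⟩)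
  have h2 := hd.mem_iff (S := {y | Sum.elim b' y ∈ S})
    (definable_slice_left (hS.mono Set.subset_union_left) fun j => Or.inr ⟨j, rfl⟩)
  refine h1.trans (Iff.trans ?_ h2.symm)
  refine Filter.congr_sets ?_
  filter_upwards [hU] with y hy
  exact hb {x | Sum.elim x y ∈ S} (definable_slice hS hy)

end RealizesUltra

theorem IsMonster.exists_realizesUltra (hm : IsMonster L 𝕄 κ) {α : Type u}
    (hα : Cardinal.mk α < κ) {C : Set 𝕄} (hC : Cardinal.mk C < κ) (U : Ultrafilter (α → 𝕄)) :
    ∃ c, RealizesUltra L U C c := by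
  obtain ⟨c, hc⟩ := exists_realization hm.2.1 hα hC (U : Filter (α → 𝕄))
  exact ⟨c, fun S hS hSU => hc S hSU hS⟩

/-- A coheir over `M` of the type of `b₀` extends to a coheir of the type of `(b₀, b)`. -/
theorem IsElemSubmodel.exists_ultrafilter_extend {M : Set 𝕄} (hM : IsElemSubmodel L M)
    {β : Type v} {δ : Type w} {V : Ultrafilter (β → 𝕄)} (hV : tuplesIn M β ∈ V) {b₀ : β → 𝕄}
    (hb₀ : RealizesUltra L V M b₀) (b : δ → 𝕄) :
    ∃ W : Ultrafilter (β ⊕ δ → 𝕄), tuplesIn M (β ⊕ δ) ∈ W ∧ W.map (· ∘ Sum.inl) = V ∧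
      RealizesUltra L W M (Sum.elim b₀ b) := by
  have : ((typeFilter L M (Sum.elim b₀ b) ⊓ Filter.comap (· ∘ Sum.inl) (V : Filter (β → 𝕄))) ⊓
      Filter.principal (tuplesIn M (β ⊕ δ))).NeBot := by
    rw [Filter.inf_principal_neBot_iff]
    intro S hS
    obtain ⟨D', ⟨D, hD, hbD, hDD'⟩, A', ⟨A, hA, hAA'⟩, rfl⟩ := Filter.mem_inf_iff.1 hS
    have hproj : {x : β → 𝕄 | ∃ z : δ → 𝕄, Sum.elim x z ∈ D} ∈ V :=
      (hb₀.mem_iff (definable_exists hD)).1 ⟨b, hbD⟩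
    obtain ⟨x, ⟨hxA, z, hz⟩, hxM⟩ :=
      V.nonempty_of_mem (Filter.inter_mem (Filter.inter_mem hA hproj) hV)
    obtain ⟨y, hy, hyM⟩ := hM.exists_mem (T := {z | Sum.elim x z ∈ D})
      (definable_slice_left hD hxM) ⟨z, hz⟩
    exact ⟨Sum.elim x y, ⟨hDD' hy, hAA' hxA⟩, by rintro (i | i); exacts [hxM i, hyM i]⟩
  have hle := Ultrafilter.of_le ((typeFilter L M (Sum.elim b₀ b) ⊓
    Filter.comap (· ∘ Sum.inl) (V : Filter (β → 𝕄))) ⊓ Filter.principal (tuplesIn M (β ⊕ δ)))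
  refine ⟨Ultrafilter.of _, Filter.le_principal_iff.1 (hle.trans inf_le_right), ?_,
    realizesUltra_of_le (hle.trans (inf_le_left.trans inf_le_left))⟩
  exact Ultrafilter.coe_le_coe.1
    (Filter.map_le_iff_le_comap.2 (hle.trans (inf_le_left.trans inf_le_right)))

end Coheirs

section Ideals

variable {L : FirstOrder.Language.{u, u}} {𝕄 : Type u} [L.Structure 𝕄] {κ : Cardinal.{u}}

/-- The fibre over `c` of a set `T` of pairs of tuples. -/
def fibre {𝕄 : Type u} {α : Type v} {γ : Type w} (T : Set (α ⊕ γ → 𝕄)) (c : γ → 𝕄) :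
    Set (α → 𝕄) :=
  {x | Sum.elim x c ∈ T}

theorem comp_sum_elim {α : Type v} {γ : Type w} (σ : 𝕄 → 𝕄) (x : α → 𝕄) (c : γ → 𝕄) :
    σ ∘ Sum.elim x c = Sum.elim (σ ∘ x) (σ ∘ c) := by
  ext (i | i) <;> rfl

theorem preimage_fibre {M : Set 𝕄} {σ : 𝕄 ≃[L] 𝕄} (hσ : ∀ m ∈ M, σ m = m) {α : Type v}
    {γ : Type w} {T : Set (α ⊕ γ → 𝕄)} (hT : M.Definable L T) (c : γ → 𝕄) :
    {x | ⇑σ ∘ x ∈ fibre T (⇑σ ∘ c)} = fibre T c := by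
  ext x
  have := comp_mem_iff_of_fixes hσ hT (Sum.elim x c)
  rwa [comp_sum_elim] at this

/-- An ideal of sets of `α`-tuples which is invariant under automorphisms over `M`. -/
structure IsInvariantIdeal (L : FirstOrder.Language.{u, u}) {𝕄 : Type u} [L.Structure 𝕄]
    (M : Set 𝕄) {α : Type v} (𝓘 : Set (α → 𝕄) → Prop) : Prop where
  empty : 𝓘 ∅
  mono : ∀ {S T : Set (α → 𝕄)}, 𝓘 T → S ⊆ T → 𝓘 S
  union : ∀ {S T : Set (α → 𝕄)}, 𝓘 S → 𝓘 T → 𝓘 (S ∪ T)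
  invariant : ∀ {σ : 𝕄 ≃[L] 𝕄}, (∀ m ∈ M, σ m = m) → ∀ {S : Set (α → 𝕄)},
    𝓘 S → 𝓘 {x | ⇑σ ∘ x ∈ S}

theorem symm_fixes {M : Set 𝕄} {σ : 𝕄 ≃[L] 𝕄} (hσ : ∀ m ∈ M, σ m = m) :
    ∀ m ∈ M, σ.symm m = m := by
  intro m hm
  conv_lhs => rw [← hσ m hm]
  exact σ.symm_apply_apply m

theorem symm_comp_comp {α : Type v} (σ : 𝕄 ≃[L] 𝕄) (x : α → 𝕄) : ⇑σ.symm ∘ ⇑σ ∘ x = x :=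
  funext fun _ => σ.symm_apply_apply _

theorem comp_symm_comp {α : Type v} (σ : 𝕄 ≃[L] 𝕄) (x : α → 𝕄) : ⇑σ ∘ ⇑σ.symm ∘ x = x :=
  funext fun _ => σ.apply_symm_apply _

theorem IsInvariantIdeal.fibre_congr {M : Set 𝕄} {α : Type v} {𝓘 : Set (α → 𝕄) → Prop}
    (h𝓘 : IsInvariantIdeal L M 𝓘) (hm : IsMonster L 𝕄 κ) (hM : Cardinal.mk M < κ) {γ : Type u}
    (hγ : Cardinal.mk γ < κ) {c d : γ → 𝕄} (hcd : SameType L M c d) {T : Set (α ⊕ γ → 𝕄)}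
    (hT : M.Definable L T) (h : 𝓘 (fibre T d)) : 𝓘 (fibre T c) := by
  obtain ⟨σ, hσ, rfl⟩ := hm.exists_equiv hγ hM hcd
  rw [← preimage_fibre hσ hT]
  exact h𝓘.invariant hσ h

/-- Definability with a small set of parameters. -/
def SmallDefinable (L : FirstOrder.Language.{u, u}) {𝕄 : Type u} [L.Structure 𝕄]
    (κ : Cardinal.{u}) (M : Set 𝕄) {α : Type v} (S : Set (α → 𝕄)) : Prop :=
  ∃ C : Set 𝕄, Cardinal.mk C < κ ∧ M ⊆ C ∧ C.Definable L S

/-- A definable set `S` such that, for `c` independent from the parameters of `S`, whenever a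
set `M`-definable over `c` is covered by `S` modulo the ideal `𝓘`, it already lies in `𝓘`. -/
def CoheirNull (L : FirstOrder.Language.{u, u}) {𝕄 : Type u} [L.Structure 𝕄]
    (κ : Cardinal.{u}) (M : Set 𝕄) {α : Type v} (𝓘 : Set (α → 𝕄) → Prop)
    (S : Set (α → 𝕄)) : Prop :=
  SmallDefinable L κ M S ∧ ∀ C : Set 𝕄, Cardinal.mk C < κ → M ⊆ C → C.Definable L S →
    ∀ γ : Type u, Cardinal.mk γ < κ → ∀ c : γ → 𝕄, IsCoheir L M C c →
      ∀ T : Set (α ⊕ γ → 𝕄), M.Definable L T → 𝓘 (fibre T c \ S) → 𝓘 (fibre T c)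

/-- Sets whose union with a null set is null. -/
def StablyNull (L : FirstOrder.Language.{u, u}) {𝕄 : Type u} [L.Structure 𝕄]
    (κ : Cardinal.{u}) (M : Set 𝕄) {α : Type v} (𝓘 : Set (α → 𝕄) → Prop)
    (S : Set (α → 𝕄)) : Prop :=
  SmallDefinable L κ M S ∧ ∀ χ, CoheirNull L κ M 𝓘 χ → CoheirNull L κ M 𝓘 (S ∪ χ)

theorem SmallDefinable.union {M : Set 𝕄} {α : Type v} {S T : Set (α → 𝕄)}
    (hm : IsMonster L 𝕄 κ) (hS : SmallDefinable L κ M S) (hT : SmallDefinable L κ M T) :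
    SmallDefinable L κ M (S ∪ T) := by
  obtain ⟨C, hC, hMC, hSC⟩ := hS
  obtain ⟨D, hD, hMD, hTD⟩ := hT
  exact ⟨C ∪ D, hm.union_lt hC hD, hMC.trans Set.subset_union_left,
    (hSC.mono Set.subset_union_left).union (hTD.mono Set.subset_union_right)⟩

theorem SmallDefinable.fibre {M : Set 𝕄} {α : Type v} (hm : IsMonster L 𝕄 κ)
    (hM : Cardinal.mk M < κ) {γ : Type u} (hγ : Cardinal.mk γ < κ) (c : γ → 𝕄)
    {T : Set (α ⊕ γ → 𝕄)} (hT : M.Definable L T) : SmallDefinable L κ M (fibre T c) :=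
  ⟨M ∪ Set.range c, hm.union_lt hM (mk_range_lt hγ c), Set.subset_union_left,
    definable_slice (hT.mono Set.subset_union_left) fun j => Or.inr ⟨j, rfl⟩⟩

namespace CoheirNull

variable {M : Set 𝕄} {α : Type v} {𝓘 : Set (α → 𝕄) → Prop} {S : Set (α → 𝕄)}

/-- Nullity may be tested over a single small set of parameters. -/
theorem of_forall (h𝓘 : IsInvariantIdeal L M 𝓘) (hm : IsMonster L 𝕄 κ) {C : Set 𝕄}
    (hC : Cardinal.mk C < κ) (hMC : M ⊆ C) (hS : C.Definable L S)
    (h : ∀ γ : Type u, Cardinal.mk γ < κ → ∀ c : γ → 𝕄, IsCoheir L M C c →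
      ∀ T : Set (α ⊕ γ → 𝕄), M.Definable L T → 𝓘 (fibre T c \ S) → 𝓘 (fibre T c)) :
    CoheirNull L κ M 𝓘 S := by
  refine ⟨⟨C, hC, hMC, hS⟩, fun D hD hMD hSD γ hγ c hc T hT hTS => ?_⟩
  obtain ⟨U, hUM, hU⟩ := hc.exists_ultrafilter
  obtain ⟨d, hd⟩ := hm.exists_realizesUltra hγ (hm.union_lt hC hD) U
  obtain ⟨σ, hσ, rfl⟩ := hm.exists_equiv hγ hD
    ((hd.mono Set.subset_union_right).sameType hU)
  have hσM : ∀ m ∈ M, σ m = m := fun m hm => hσ m (hMD hm)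
  have key := h γ hγ d ((hd.mono Set.subset_union_left).isCoheir hUM) T hT ?_
  · have := h𝓘.invariant (symm_fixes hσM) key
    have h2 := preimage_fibre (symm_fixes hσM) hT (⇑σ ∘ d)
    rw [symm_comp_comp] at h2
    rwa [h2] at this
  · refine h𝓘.mono (h𝓘.invariant hσM hTS) ?_
    rintro x ⟨hx, hxS⟩
    refine ⟨?_, fun h => hxS ((comp_mem_iff_of_fixes hσ hSD x).1 h)⟩
    rw [← preimage_fibre hσM hT] at hx
    exact hx

theorem empty (hM : Cardinal.mk M < κ) : CoheirNull L κ M 𝓘 ∅ :=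
  ⟨⟨M, hM, subset_rfl, Set.definable_empty⟩, fun _ _ _ _ _ _ _ _ _ _ h => by
    rwa [Set.sdiff_empty] at h⟩

theorem mono (h𝓘 : IsInvariantIdeal L M 𝓘) (hm : IsMonster L 𝕄 κ) {S' : Set (α → 𝕄)}
    (h : CoheirNull L κ M 𝓘 S) (hS' : SmallDefinable L κ M S') (hSS' : S' ⊆ S) :
    CoheirNull L κ M 𝓘 S' := by
  obtain ⟨C, hC, hMC, hSC⟩ := h.1
  obtain ⟨D, hD, hMD, hSD⟩ := hS'
  have hMCD : M ⊆ C ∪ D := hMC.trans Set.subset_union_left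
  refine of_forall h𝓘 hm (hm.union_lt hC hD) hMCD
    (hSD.mono Set.subset_union_right) fun γ hγ c hc T hT hTS => ?_
  exact h.2 _ (hm.union_lt hC hD) hMCD (hSC.mono Set.subset_union_left) γ hγ c hc T hT
    (h𝓘.mono hTS (Set.sdiff_subset_sdiff_right hSS'))

theorem preimage (h𝓘 : IsInvariantIdeal L M 𝓘) (hm : IsMonster L 𝕄 κ)
    (h : CoheirNull L κ M 𝓘 S) {σ : 𝕄 ≃[L] 𝕄} (hσ : ∀ m ∈ M, σ m = m) :
    CoheirNull L κ M 𝓘 {x | ⇑σ ∘ x ∈ S} := by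
  obtain ⟨C, hC, hMC, hSC⟩ := h.1
  have hCC : σ '' (σ.symm '' C) = C := by
    rw [Set.image_image]
    simp
  refine of_forall h𝓘 hm (C := σ.symm '' C) (Cardinal.mk_image_le.trans_lt hC) ?_
    (definable_preimage_equiv σ (by rwa [hCC])) fun γ hγ c hc T hT hTS => ?_
  · exact fun m hm => ⟨m, hMC hm, symm_fixes hσ m hm⟩
  · have hc' := hc.map hσ
    rw [hCC] at hc'
    have key := h.2 C hC hMC hSC γ hγ _ hc' T hT ?_
    · rw [← preimage_fibre hσ hT]
      exact h𝓘.invariant hσ key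
    · refine h𝓘.mono (h𝓘.invariant (symm_fixes hσ) hTS) ?_
      rintro x ⟨hx, hxS⟩
      refine ⟨?_, fun h => hxS ?_⟩
      · rw [← preimage_fibre (symm_fixes hσ) hT, symm_comp_comp] at hx
        exact hx
      · rwa [Set.mem_ofPred_eq, comp_symm_comp] at h

theorem fibre_congr (h𝓘 : IsInvariantIdeal L M 𝓘) (hm : IsMonster L 𝕄 κ)
    (hM : Cardinal.mk M < κ) {γ : Type u} (hγ : Cardinal.mk γ < κ) {c d : γ → 𝕄}
    (hcd : SameType L M c d) {T : Set (α ⊕ γ → 𝕄)} (hT : M.Definable L T)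
    (h : CoheirNull L κ M 𝓘 (fibre T d)) : CoheirNull L κ M 𝓘 (fibre T c) := by
  obtain ⟨σ, hσ, rfl⟩ := hm.exists_equiv hγ hM hcd
  rw [← preimage_fibre hσ hT]
  exact h.preimage h𝓘 hm hσ

theorem union_fibre (h𝓘 : IsInvariantIdeal L M 𝓘) (hm : IsMonster L 𝕄 κ) {C : Set 𝕄}
    (hC : Cardinal.mk C < κ) (hMC : M ⊆ C) (hSC : C.Definable L S)
    (hS : CoheirNull L κ M 𝓘 S) {β : Type u} (hβ : Cardinal.mk β < κ) {b : β → 𝕄}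
    (hb : IsCoheir L M C b) {X : Set (α ⊕ β → 𝕄)} (hX : M.Definable L X)
    (hXb : CoheirNull L κ M 𝓘 (fibre X b)) : CoheirNull L κ M 𝓘 (S ∪ fibre X b) := by
  have hCb : Cardinal.mk ↑(C ∪ Set.range b) < κ := hm.union_lt hC (mk_range_lt hβ b)
  have hMCb : M ⊆ C ∪ Set.range b := hMC.trans Set.subset_union_left
  have hXC : (C ∪ Set.range b).Definable L (fibre X b) :=
    definable_slice (hX.mono hMCb) fun j => Or.inr ⟨j, rfl⟩
  refine of_forall h𝓘 hm hCb hMCb ((hSC.mono Set.subset_union_left).union hXC)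
    fun γ hγ c hc T hT hTS => ?_
  refine hXb.2 _ hCb hMCb hXC γ hγ c hc T hT ?_
  let T' : Set (α ⊕ (β ⊕ γ) → 𝕄) :=
    {v | v ∘ Sum.map id Sum.inr ∈ T} \ {v | v ∘ Sum.map id Sum.inl ∈ X}
  have hT' : M.Definable L T' := (definable_relabel hT _).sdiff (definable_relabel hX _)
  have hfib : fibre T' (Sum.elim b c) = fibre T c \ fibre X b := by
    have h1 : ∀ x : α → 𝕄, Sum.elim x (Sum.elim b c) ∘ Sum.map id Sum.inr = Sum.elim x c :=
      fun x => by ext (i | i) <;> rfl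
    have h2 : ∀ x : α → 𝕄, Sum.elim x (Sum.elim b c) ∘ Sum.map id Sum.inl = Sum.elim x b :=
      fun x => by ext (i | i) <;> rfl
    ext x
    simp only [fibre, T', Set.mem_sdiff, Set.mem_ofPred_eq, h1, h2]
  rw [← hfib]
  refine hS.2 C hC hMC hSC (β ⊕ γ) (hm.sum_lt hβ hγ) _ (hb.sum_elim hMC hc) T' hT' ?_
  rw [hfib, Set.sdiff_sdiff, Set.union_comm]
  exact hTS

end CoheirNull

namespace StablyNull

variable {M : Set 𝕄} {α : Type v} {𝓘 : Set (α → 𝕄) → Prop} {S T : Set (α → 𝕄)}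

theorem union (hm : IsMonster L 𝕄 κ) (hS : StablyNull L κ M 𝓘 S) (hT : StablyNull L κ M 𝓘 T) :
    StablyNull L κ M 𝓘 (S ∪ T) :=
  ⟨hS.1.union hm hT.1, fun χ hχ => by
    rw [Set.union_assoc]
    exact hS.2 _ (hT.2 _ hχ)⟩

theorem mono (h𝓘 : IsInvariantIdeal L M 𝓘) (hm : IsMonster L 𝕄 κ) (hT : StablyNull L κ M 𝓘 T)
    (hS : SmallDefinable L κ M S) (hST : S ⊆ T) : StablyNull L κ M 𝓘 S :=
  ⟨hS, fun _ hχ => (hT.2 _ hχ).mono h𝓘 hm (hS.union hm hχ.1)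
    (Set.union_subset_union_left _ hST)⟩

theorem coheirNull (hM : Cardinal.mk M < κ) (hS : StablyNull L κ M 𝓘 S) :
    CoheirNull L κ M 𝓘 S := by
  have := hS.2 ∅ (CoheirNull.empty hM)
  rwa [Set.union_empty] at this

theorem of_mem (h𝓘 : IsInvariantIdeal L M 𝓘) (hm : IsMonster L 𝕄 κ) (hS : 𝓘 S)
    (hSdef : SmallDefinable L κ M S) : StablyNull L κ M 𝓘 S := by
  refine ⟨hSdef, fun χ hχ => ?_⟩
  obtain ⟨C, hC, hMC, hSC⟩ := hSdef
  obtain ⟨D, hD, hMD, hSD⟩ := hχ.1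
  have hMCD : M ⊆ C ∪ D := hMC.trans Set.subset_union_left
  refine CoheirNull.of_forall h𝓘 hm (hm.union_lt hC hD) hMCD
    ((hSC.mono Set.subset_union_left).union (hSD.mono Set.subset_union_right))
    fun γ hγ c hc T hT hTS => ?_
  refine hχ.2 _ (hm.union_lt hC hD) hMCD (hSD.mono Set.subset_union_right) γ hγ c hc T hT
    (h𝓘.mono (h𝓘.union hTS hS) ?_)
  rintro x ⟨hxT, hxχ⟩
  by_cases hxS : x ∈ S
  · exact Or.inr hxS
  · exact Or.inl ⟨hxT, fun h => h.elim hxS hxχ⟩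

theorem not_univ (h𝓘 : IsInvariantIdeal L M 𝓘) (hM : Cardinal.mk M < κ)
    (huniv : ¬ 𝓘 Set.univ) (hm : IsMonster L 𝕄 κ) : ¬ StablyNull L κ M 𝓘 Set.univ := by
  intro h
  refine huniv ?_
  have := (h.coheirNull hM).2 M hM subset_rfl Set.definable_univ PEmpty
    (by simpa using Cardinal.aleph0_pos.trans hm.1) PEmpty.elim
    (fun S _ hc => ⟨_, hc, fun i => i.elim⟩) Set.univ Set.definable_univ
    (by rw [Set.sdiff_univ]; exact h𝓘.empty)
  simpa [fibre] using this

end StablyNull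

end Ideals

section Morley

variable {L : FirstOrder.Language.{u, u}} {𝕄 : Type u} [L.Structure 𝕄] {κ : Cardinal.{u}}

/-- `M` together with the terms of `J` before the `i`-th. -/
def initialSet {𝕄 : Type u} (M : Set 𝕄) {β : Type v} (J : ℕ → β → 𝕄) (i : ℕ) : Set 𝕄 :=
  M ∪ ⋃ (j : ℕ) (_ : j < i), Set.range (J j)

theorem subset_initialSet {M : Set 𝕄} {β : Type v} (J : ℕ → β → 𝕄) (i : ℕ) :
    M ⊆ initialSet M J i :=
  Set.subset_union_left

theorem mem_initialSet_of_lt {M : Set 𝕄} {β : Type v} (J : ℕ → β → 𝕄) {i j : ℕ} (hij : j < i)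
    (x : β) : J j x ∈ initialSet M J i :=
  Or.inr (Set.mem_iUnion₂.2 ⟨j, hij, x, rfl⟩)

theorem initialSet_subset {M D : Set 𝕄} {β : Type v} {J : ℕ → β → 𝕄} {i : ℕ} (hM : M ⊆ D)
    (h : ∀ j < i, ∀ x, J j x ∈ D) : initialSet M J i ⊆ D := by
  refine Set.union_subset hM (Set.iUnion₂_subset fun j hj => ?_)
  rintro _ ⟨x, rfl⟩
  exact h j hj x

theorem initialSet_mono {M : Set 𝕄} {β : Type v} (J : ℕ → β → 𝕄) {i k : ℕ} (h : i ≤ k) :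
    initialSet M J i ⊆ initialSet M J k :=
  initialSet_subset (subset_initialSet _ _) fun _ hj => mem_initialSet_of_lt J (hj.trans_le h)

theorem IsMonster.initialSet_lt (hm : IsMonster L 𝕄 κ) {M : Set 𝕄} (hM : Cardinal.mk M < κ)
    {β : Type u} (hβ : Cardinal.mk β < κ) (J : ℕ → β → 𝕄) (i : ℕ) :
    Cardinal.mk (initialSet M J i) < κ := by
  have h : initialSet M J i ⊆ M ∪ ⋃ j, Set.range (J j) :=
    initialSet_subset Set.subset_union_left fun j _ x => Or.inr (Set.mem_iUnion.2 ⟨j, x, rfl⟩)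
  exact (Cardinal.mk_le_mk_of_subset h).trans_lt (hm.union_lt hM (hm.iUnion_range_lt hβ J))

/-- Coheir Morley sequences, phrased with ultrafilters. -/
def IsUltraMorley (L : FirstOrder.Language.{u, u}) {𝕄 : Type u} [L.Structure 𝕄] (M : Set 𝕄)
    {β : Type v} (I : ℕ → β → 𝕄) : Prop :=
  ∃ V : Ultrafilter (β → 𝕄), tuplesIn M β ∈ V ∧
    ∀ i, RealizesUltra L V (initialSet M I i) (I i)

/-- Extend an initial segment of a coheir Morley sequence to a coheir Morley sequence in a
larger coheir. -/
theorem IsMonster.exists_sequence_extend (hm : IsMonster L 𝕄 κ) {M : Set 𝕄}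
    (hM : Cardinal.mk M < κ) {β δ : Type u} (hβ : Cardinal.mk β < κ) (hδ : Cardinal.mk δ < κ)
    {W : Ultrafilter (β ⊕ δ → 𝕄)} (hW : tuplesIn M (β ⊕ δ) ∈ W) {I : ℕ → β → 𝕄}
    (hI : ∀ i, RealizesUltra L (W.map (· ∘ Sum.inl)) (initialSet M I i) (I i)) (k : ℕ) :
    ∃ J : ℕ → β ⊕ δ → 𝕄, ∀ i < k, J i ∘ Sum.inl = I i ∧
      RealizesUltra L W (initialSet M J i) (J i) := by
  induction k with
  | zero =>
    obtain ⟨w, -⟩ := W.nonempty_of_mem hW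
    exact ⟨fun _ => w, fun i hi => by omega⟩
  | succ k ih =>
    obtain ⟨J, hJ⟩ := ih
    have hβδ := hm.sum_lt hβ hδ
    obtain ⟨e, he⟩ := hm.exists_realizesUltra hβδ (hm.initialSet_lt hM hβδ J k) W
    let J₁ := Function.update J k e
    have hJ₁ : ∀ j < k, J₁ j = J j := fun j hj => Function.update_of_ne hj.ne _ _
    have hJ₁k : J₁ k = e := Function.update_self _ _ _
    have hinit : ∀ i ≤ k, initialSet M J₁ i ⊆ initialSet M J i := fun i hi =>
      initialSet_subset (subset_initialSet _ _) fun j hj x => by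
        rw [hJ₁ j (by omega)]
        exact mem_initialSet_of_lt J hj x
    have hJW : ∀ i < k + 1, RealizesUltra L W (initialSet M J₁ i) (J₁ i) := by
      intro i hi
      rcases (Nat.lt_succ_iff.1 hi).eq_or_lt with rfl | hik
      · rw [hJ₁k]
        exact he.mono (hinit _ le_rfl)
      · rw [hJ₁ i hik]
        exact (hJ i hik).2.mono (hinit i hik.le)
    have hIk : initialSet M I k ⊆ initialSet M J k :=
      initialSet_subset (subset_initialSet _ _) fun j hj x => by
        rw [← (hJ j hj).1]
        exact mem_initialSet_of_lt J hj _
    obtain ⟨σ, hσ, hσe⟩ := hm.exists_equiv hβ (hm.initialSet_lt hM hβ I k)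
      (((he.comp Sum.inl).mono hIk).sameType (hI k))
    have hσM : ∀ m ∈ M, σ m = m := fun m hm => hσ m (subset_initialSet _ _ hm)
    refine ⟨fun i => ⇑σ ∘ J₁ i, fun i hi => ⟨?_, ?_⟩⟩
    · rcases (Nat.lt_succ_iff.1 hi).eq_or_lt with rfl | hik
      · change ⇑σ ∘ J₁ i ∘ Sum.inl = I i
        rw [hJ₁k]
        exact hσe
      · change ⇑σ ∘ J₁ i ∘ Sum.inl = I i
        rw [hJ₁ i hik, (hJ i hik).1]
        exact funext fun x => hσ _ (mem_initialSet_of_lt I hik x)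
    · refine ((hJW i hi).map hW hσM).mono (initialSet_subset ?_ ?_)
      · exact fun m hm => ⟨m, subset_initialSet _ _ hm, hσM m hm⟩
      · exact fun j hj x => ⟨_, mem_initialSet_of_lt J₁ hj x, rfl⟩

theorem IsInvariantIdeal.biUnion_lt {M : Set 𝕄} {α : Type v} {𝓘 : Set (α → 𝕄) → Prop}
    (h𝓘 : IsInvariantIdeal L M 𝓘) (k : ℕ) {S : ℕ → Set (α → 𝕄)} (h : ∀ i < k, 𝓘 (S i)) :
    𝓘 {x | ∃ i < k, x ∈ S i} := by
  induction k with
  | zero => exact h𝓘.mono h𝓘.empty fun x ⟨i, hi, _⟩ => by omega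
  | succ k ih =>
    refine h𝓘.mono (h𝓘.union (ih fun i hi => h i (by omega)) (h k (by omega))) ?_
    rintro x ⟨i, hi, hx⟩
    rcases (Nat.lt_succ_iff.1 hi).eq_or_lt with rfl | hik
    · exact Or.inr hx
    · exact Or.inl ⟨i, hik, hx⟩

/-- The union of finitely many translates of a null set along a coheir Morley sequence
is null. -/
theorem CoheirNull.union_morley {M : Set 𝕄} {α : Type v} {𝓘 : Set (α → 𝕄) → Prop}
    (h𝓘 : IsInvariantIdeal L M 𝓘) (hm : IsMonster L 𝕄 κ) (hM : Cardinal.mk M < κ) {δ : Type u}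
    (hδ : Cardinal.mk δ < κ) {J : ℕ → δ → 𝕄} {X : Set (α ⊕ δ → 𝕄)} (hX : M.Definable L X)
    (k : ℕ) (hJ : ∀ i < k, IsCoheir L M (initialSet M J i) (J i))
    (hnull : ∀ i < k, CoheirNull L κ M 𝓘 (fibre X (J i))) :
    (initialSet M J k).Definable L {x | ∃ i < k, x ∈ fibre X (J i)} ∧
      CoheirNull L κ M 𝓘 {x | ∃ i < k, x ∈ fibre X (J i)} := by
  induction k with
  | zero =>
    have : {x | ∃ i < 0, x ∈ fibre X (J i)} = ∅ :=
      Set.eq_empty_of_forall_notMem fun x ⟨i, hi, _⟩ => by omega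
    rw [this]
    exact ⟨Set.definable_empty, CoheirNull.empty hM⟩
  | succ k ih =>
    obtain ⟨h1, h2⟩ := ih (fun i hi => hJ i (by omega)) fun i hi => hnull i (by omega)
    have : {x | ∃ i < k + 1, x ∈ fibre X (J i)} =
        {x | ∃ i < k, x ∈ fibre X (J i)} ∪ fibre X (J k) := by
      ext x
      simp only [Set.mem_ofPred_eq, Set.mem_union, Nat.lt_succ_iff_lt_or_eq]
      constructor
      · rintro ⟨i, hi | rfl, hx⟩
        exacts [Or.inl ⟨i, hi, hx⟩, Or.inr hx]
      · rintro (⟨i, hi, hx⟩ | hx)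
        exacts [⟨i, Or.inl hi, hx⟩, ⟨k, Or.inr rfl, hx⟩]
    rw [this]
    refine ⟨(h1.mono (initialSet_mono J k.le_succ)).union
      (definable_slice (hX.mono (subset_initialSet _ _))
        fun x => mem_initialSet_of_lt J k.lt_succ_self x), ?_⟩
    exact h2.union_fibre h𝓘 hm (hm.initialSet_lt hM hδ J k) (subset_initialSet _ _) h1 hδ
      (hJ k k.lt_succ_self) hX (hnull k k.lt_succ_self)

theorem smallDefinable_forall_lt {M : Set 𝕄} {α : Type v} (hm : IsMonster L 𝕄 κ)
    (hM : Cardinal.mk M < κ) {β : Type u} (hβ : Cardinal.mk β < κ) {T : Set (α ⊕ β → 𝕄)}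
    (hT : M.Definable L T) (I : ℕ → β → 𝕄) (k : ℕ) :
    SmallDefinable L κ M {x | ∀ i < k, x ∈ fibre T (I i)} := by
  refine ⟨initialSet M I k, hm.initialSet_lt hM hβ I k, subset_initialSet _ _, ?_⟩
  have : {x | ∀ i < k, x ∈ fibre T (I i)} = ⋂ i ∈ Finset.range k, fibre T (I i) := by
    ext x
    simp
  rw [this]
  suffices h : ∀ s : Finset ℕ, (∀ i ∈ s, i < k) →
      (initialSet M I k).Definable L (⋂ i ∈ s, fibre T (I i)) from
    h _ fun i hi => Finset.mem_range.1 hi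
  classical
  intro s
  induction s using Finset.induction_on with
  | empty => exact fun _ => by simp
  | insert i s _ ih =>
    intro hs
    rw [Finset.set_biInter_insert]
    exact (definable_slice (hT.mono (subset_initialSet _ _)) fun x =>
      mem_initialSet_of_lt I (hs i (Finset.mem_insert_self _ _)) x).inter
        (ih fun j hj => hs j (Finset.mem_insert_of_mem hj))

/-- Stably null sets are closed under Kim-dividing along coheir Morley sequences. -/
theorem StablyNull.of_morley {M : Set 𝕄} {α : Type v} {𝓘 : Set (α → 𝕄) → Prop}
    (h𝓘 : IsInvariantIdeal L M 𝓘) (hm : IsMonster L 𝕄 κ) (hMel : IsElemSubmodel L M)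
    (hM : Cardinal.mk M < κ) {β : Type u}
    (hβ : Cardinal.mk β < κ) {I : ℕ → β → 𝕄} (hI : IsUltraMorley L M I)
    {T : Set (α ⊕ β → 𝕄)} (hT : M.Definable L T) (k : ℕ)
    (h : StablyNull L κ M 𝓘 {x | ∀ i < k, x ∈ fibre T (I i)}) :
    StablyNull L κ M 𝓘 (fibre T (I 0)) := by
  refine ⟨SmallDefinable.fibre hm hM hβ _ hT, fun χ hχ => ?_⟩
  obtain ⟨V, hV, hVI⟩ := hI
  obtain ⟨D, hD, hMD, hχD⟩ := hχ.1
  let b : D → 𝕄 := fun m => m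
  obtain ⟨X, hX, rfl⟩ := exists_slice (C := M) (c := b) (S := χ)
    (hχD.mono (by rw [Subtype.range_coe]; exact Set.subset_union_right))
  change CoheirNull L κ M 𝓘 (fibre X b) at hχ
  change CoheirNull L κ M 𝓘 (fibre T (I 0) ∪ fibre X b)
  obtain ⟨W, hW, rfl, hWb⟩ := hMel.exists_ultrafilter_extend hV
    ((hVI 0).mono (subset_initialSet _ _)) b
  obtain ⟨J, hJ⟩ := hm.exists_sequence_extend hM hβ hD hW hVI k
  have hβD := hm.sum_lt hβ hD
  let J₀ : β ⊕ D → 𝕄 := Sum.elim (I 0) b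
  have hJtype : ∀ i < k, SameType L M (J i) J₀ := fun i hi =>
    ((hJ i hi).2.mono (subset_initialSet _ _)).sameType hWb
  let X' : Set (α ⊕ (β ⊕ D) → 𝕄) := {v | v ∘ Sum.map id Sum.inr ∈ X}
  let T' : Set (α ⊕ (β ⊕ D) → 𝕄) := {v | v ∘ Sum.map id Sum.inl ∈ T}
  have hX' : M.Definable L X' := definable_relabel hX _
  have hT' : M.Definable L T' := definable_relabel hT _
  have h1 : ∀ (x : α → 𝕄) (c : β ⊕ D → 𝕄),
      Sum.elim x c ∘ Sum.map id Sum.inr = Sum.elim x (c ∘ Sum.inr) :=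
    fun x c => by ext (i | i) <;> rfl
  have h2 : ∀ (x : α → 𝕄) (c : β ⊕ D → 𝕄),
      Sum.elim x c ∘ Sum.map id Sum.inl = Sum.elim x (c ∘ Sum.inl) :=
    fun x c => by ext (i | i) <;> rfl
  have hX'f : ∀ c, fibre X' c = fibre X (c ∘ Sum.inr) := fun c => by
    ext x
    simp only [fibre, X', Set.mem_ofPred_eq, h1]
  have hT'f : ∀ c, fibre T' c = fibre T (c ∘ Sum.inl) := fun c => by
    ext x
    simp only [fibre, T', Set.mem_ofPred_eq, h2]
  have hX₀ : fibre X' J₀ = fibre X b := hX'f J₀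
  have hT₀ : fibre T' J₀ = fibre T (I 0) := hT'f J₀
  have hTi : ∀ i < k, fibre T' (J i) = fibre T (I i) := fun i hi => by
    rw [hT'f, (hJ i hi).1]
  rw [← hX₀] at hχ ⊢
  rw [← hT₀]
  obtain ⟨-, hunion⟩ := CoheirNull.union_morley h𝓘 hm hM hβD hX' k
    (fun i hi => (hJ i hi).2.isCoheir hW)
    fun i hi => CoheirNull.fibre_congr h𝓘 hm hM hβD (hJtype i hi) hX' hχ
  have hbig := h.2 _ hunion
  let C₁ : Set 𝕄 := M ∪ Set.range J₀
  have hC₁ : Cardinal.mk C₁ < κ := hm.union_lt hM (mk_range_lt hβD J₀)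
  have hMC₁ : M ⊆ C₁ := Set.subset_union_left
  refine CoheirNull.of_forall h𝓘 hm hC₁ hMC₁
    ((definable_slice (hT'.mono hMC₁) fun j => Or.inr ⟨j, rfl⟩).union
      (definable_slice (hX'.mono hMC₁) fun j => Or.inr ⟨j, rfl⟩)) fun γ hγ c hc Y hY hYS => ?_
  obtain ⟨U, hUM, hU⟩ := hc.exists_ultrafilter
  obtain ⟨E, hE, hME, hEdef⟩ := hbig.1
  have hEJ : Cardinal.mk ↑(E ∪ initialSet M J k) < κ :=
    hm.union_lt hE (hm.initialSet_lt hM hβD J k)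
  obtain ⟨d, hd⟩ := hm.exists_realizesUltra hγ hEJ U
  have hMEJ : M ⊆ E ∪ initialSet M J k := hME.trans Set.subset_union_left
  refine h𝓘.fibre_congr hm hM hγ ((hU.mono hMC₁).sameType (hd.mono hMEJ)) hY ?_
  refine hbig.2 _ hEJ hMEJ (hEdef.mono Set.subset_union_left) γ hγ d (hd.isCoheir hUM) Y hY ?_
  let Z : Set (α ⊕ ((β ⊕ D) ⊕ γ) → 𝕄) :=
    {v | v ∘ Sum.map id Sum.inr ∈ Y} \
      ({v | v ∘ Sum.map id Sum.inl ∈ T'} ∪ {v | v ∘ Sum.map id Sum.inl ∈ X'})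
  have hZ : M.Definable L Z :=
    (definable_relabel hY _).sdiff ((definable_relabel hT' _).union (definable_relabel hX' _))
  have h3 : ∀ (x : α → 𝕄) (p : β ⊕ D → 𝕄) (q : γ → 𝕄),
      Sum.elim x (Sum.elim p q) ∘ Sum.map id Sum.inr = Sum.elim x q :=
    fun x p q => by ext (i | i) <;> rfl
  have h4 : ∀ (x : α → 𝕄) (p : β ⊕ D → 𝕄) (q : γ → 𝕄),
      Sum.elim x (Sum.elim p q) ∘ Sum.map id Sum.inl = Sum.elim x p :=
    fun x p q => by ext (i | i) <;> rfl
  have hZf : ∀ (p : β ⊕ D → 𝕄) (q : γ → 𝕄),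
      fibre Z (Sum.elim p q) = fibre Y q \ (fibre T' p ∪ fibre X' p) := fun p q => by
    ext x
    simp only [fibre, Z, Set.mem_sdiff, Set.mem_union, Set.mem_ofPred_eq, h3, h4]
  rw [← hZf] at hYS
  have hi : ∀ i < k, 𝓘 (fibre Y d \ (fibre T' (J i) ∪ fibre X' (J i))) := fun i hi => by
    rw [← hZf]
    refine h𝓘.fibre_congr hm hM (hm.sum_lt hβD hγ) ?_ hZ hYS
    refine RealizesUltra.sameType_sum_elim (hd.mono ?_) hU hUM (hJtype i hi)
    refine Set.union_subset hMEJ ?_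
    rintro _ ⟨x, rfl⟩
    exact Or.inr (mem_initialSet_of_lt J hi x)
  refine h𝓘.mono (h𝓘.biUnion_lt k hi) ?_
  rintro x ⟨hxY, hx⟩
  have hx1 : ∃ i < k, x ∉ fibre T (I i) := by
    by_contra! hcon
    exact hx (Or.inl hcon)
  obtain ⟨i, hik, hxi⟩ := hx1
  refine ⟨i, hik, hxY, ?_⟩
  rintro (hx' | hx')
  · rw [hTi i hik] at hx'
    exact hxi hx'
  · exact hx (Or.inr ⟨i, hik, hx'⟩)

end Morley

section Independence

variable {L : FirstOrder.Language.{u, u}} {𝕄 : Type u} [L.Structure 𝕄] {κ : Cardinal.{u}}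

/-- Sets contained in an `M`-definable family of sets whose fibres over tuples from `M` all
avoid `a`. -/
def HeirSmall (L : FirstOrder.Language.{u, u}) {𝕄 : Type u} [L.Structure 𝕄] (M : Set 𝕄)
    {α : Type v} (a : α → 𝕄) (S : Set (α → 𝕄)) : Prop :=
  ∃ (γ : Type u) (_ : Finite γ) (c : γ → 𝕄) (T : Set (α ⊕ γ → 𝕄)),
    M.Definable L T ∧ S ⊆ fibre T c ∧ ∀ d : γ → 𝕄, (∀ j, d j ∈ M) → Sum.elim a d ∉ T

namespace HeirSmall

variable {M : Set 𝕄} {α : Type v} {a b : α → 𝕄} {S S' : Set (α → 𝕄)}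

theorem mono (h : HeirSmall L M a S) (hS : S' ⊆ S) : HeirSmall L M a S' := by
  obtain ⟨γ, hγ, c, T, hT, hST, hd⟩ := h
  exact ⟨γ, hγ, c, T, hT, hS.trans hST, hd⟩

theorem union (h : HeirSmall L M a S) (h' : HeirSmall L M a S') :
    HeirSmall L M a (S ∪ S') := by
  obtain ⟨γ, hγ, c, T, hT, hST, hd⟩ := h
  obtain ⟨γ', hγ', c', T', hT', hST', hd'⟩ := h'
  have h1 : ∀ (x : α → 𝕄) (e : γ ⊕ γ' → 𝕄),
      Sum.elim x e ∘ Sum.map id Sum.inl = Sum.elim x (e ∘ Sum.inl) :=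
    fun x e => by ext (i | i) <;> rfl
  have h2 : ∀ (x : α → 𝕄) (e : γ ⊕ γ' → 𝕄),
      Sum.elim x e ∘ Sum.map id Sum.inr = Sum.elim x (e ∘ Sum.inr) :=
    fun x e => by ext (i | i) <;> rfl
  refine ⟨γ ⊕ γ', inferInstance, Sum.elim c c',
    {v | v ∘ Sum.map id Sum.inl ∈ T} ∪ {v | v ∘ Sum.map id Sum.inr ∈ T'},
    (definable_relabel hT _).union (definable_relabel hT' _), ?_, ?_⟩
  · rintro x (hx | hx)
    · left
      rw [Set.mem_ofPred_eq, h1]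
      exact hST hx
    · right
      rw [Set.mem_ofPred_eq, h2]
      exact hST' hx
  · rintro e he (hx | hx)
    · rw [Set.mem_ofPred_eq, h1] at hx
      exact hd _ (fun j => he _) hx
    · rw [Set.mem_ofPred_eq, h2] at hx
      exact hd' _ (fun j => he _) hx

theorem of_definable (hS : M.Definable L S) (ha : a ∉ S) : HeirSmall L M a S :=
  ⟨PEmpty, inferInstance, PEmpty.elim, {v | v ∘ Sum.inl ∈ S}, definable_relabel hS _,
    fun _ hx => hx, fun _ _ h => ha h⟩

theorem not_univ (hM : IsElemSubmodel L M) : ¬ HeirSmall L M a Set.univ := by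
  rintro ⟨γ, hγ, c, T, hT, hST, hd⟩
  have hswap : M.Definable L {c : γ → 𝕄 | ∃ x : α → 𝕄, Sum.elim c x ∘ Sum.swap ∈ Tᶜ} :=
    definable_exists (definable_relabel hT.compl Sum.swap)
  have h1 : ∀ (c : γ → 𝕄) (x : α → 𝕄), Sum.elim c x ∘ Sum.swap = Sum.elim x c :=
    fun c x => by ext (i | i) <;> rfl
  obtain ⟨d, hdT, hdM⟩ := hM.exists_mem hswap.compl
    ⟨c, fun ⟨x, hx⟩ => hx (by rw [h1]; exact hST trivial)⟩
  refine hdT ⟨a, ?_⟩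
  rw [h1]
  exact hd d hdM

theorem preimage {σ : 𝕄 ≃[L] 𝕄} (h : HeirSmall L (σ '' M) (⇑σ ∘ a) S) :
    HeirSmall L M a {x | ⇑σ ∘ x ∈ S} := by
  obtain ⟨γ, hγ, c, T, hT, hST, hd⟩ := h
  refine ⟨γ, hγ, ⇑σ.symm ∘ c, {v | ⇑σ ∘ v ∈ T}, definable_preimage_equiv σ hT, ?_, ?_⟩
  · intro x hx
    have := hST hx
    change ⇑σ ∘ Sum.elim x (⇑σ.symm ∘ c) ∈ T
    rwa [comp_sum_elim, comp_symm_comp]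
  · intro d hdM hdT
    rw [Set.mem_ofPred_eq, comp_sum_elim] at hdT
    exact hd _ (fun j => ⟨_, hdM j, rfl⟩) hdT

theorem congr (hab : SameType L M a b) (h : HeirSmall L M a S) : HeirSmall L M b S := by
  obtain ⟨γ, hγ, c, T, hT, hST, hd⟩ := h
  exact ⟨γ, hγ, c, T, hT, hST, fun d hdM hdT =>
    hd d hdM ((hab _ (definable_slice hT hdM)).2 hdT)⟩

theorem image_eq_of_fixes {σ : 𝕄 ≃[L] 𝕄} (hσ : ∀ m ∈ M, σ m = m) : σ '' M = M := by
  rw [Set.image_congr hσ, Set.image_id']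

theorem isInvariantIdeal (M : Set 𝕄) (a : α → 𝕄) :
    IsInvariantIdeal L M (HeirSmall L M a) where
  empty := of_definable Set.definable_empty (Set.notMem_empty a)
  mono := mono
  union := union
  invariant := fun {σ} hσ {S} h => by
    refine preimage ?_
    rw [image_eq_of_fixes hσ]
    exact h.congr (SameType.of_fixes hσ a).symm

end HeirSmall

/-- Ideals of sets of `α`-tuples that contain the sets small for `tp(a / M)` and are closed
under Kim-dividing along coheir Morley sequences over `M`. -/
structure IsKimIdeal (L : FirstOrder.Language.{u, u}) {𝕄 : Type u} [L.Structure 𝕄]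
    (κ : Cardinal.{u}) (M : Set 𝕄) {α : Type v} (a : α → 𝕄) (F : Set (α → 𝕄) → Prop) :
    Prop where
  heir : ∀ {S : Set (α → 𝕄)}, HeirSmall L M a S → F S
  mono : ∀ {S T : Set (α → 𝕄)}, F T → S ⊆ T → F S
  union : ∀ {S T : Set (α → 𝕄)}, F S → F T → F (S ∪ T)
  kim : ∀ {β : Type u}, Cardinal.mk β < κ → ∀ {I : ℕ → β → 𝕄}, IsUltraMorley L M I →
    ∀ {T : Set (α ⊕ β → 𝕄)}, M.Definable L T → ∀ k : ℕ,
      F {x | ∀ i < k, x ∈ fibre T (I i)} → F (fibre T (I 0))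

/-- Some Kim-closed ideal for `tp(a / M)` contains no set in `tp(a / M ∪ C)`. -/
def KimIndep (L : FirstOrder.Language.{u, u}) {𝕄 : Type u} [L.Structure 𝕄]
    (κ : Cardinal.{u}) (M : Set 𝕄) {α : Type v} (a : α → 𝕄) (C : Set 𝕄) : Prop :=
  ∃ F, IsKimIdeal L κ M a F ∧ ∀ S, F S → (M ∪ C).Definable L S → a ∉ S

theorem exists_isKimIdeal (hm : IsMonster L 𝕄 κ) {M : Set 𝕄} (hMel : IsElemSubmodel L M)
    (hM : Cardinal.mk M < κ) {α : Type v} (a : α → 𝕄) :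
    ∃ F, IsKimIdeal L κ M a F ∧ ¬ F Set.univ := by
  have h𝓘 := HeirSmall.isInvariantIdeal (L := L) M a
  refine ⟨fun S => ∃ S', S ⊆ S' ∧ StablyNull L κ M (HeirSmall L M a) S', ⟨?_, ?_, ?_, ?_⟩, ?_⟩
  · rintro S ⟨γ, hγ, c, T, hT, hST, hd⟩
    refine ⟨fibre T c, hST, StablyNull.of_mem h𝓘 hm ⟨γ, hγ, c, T, hT, subset_rfl, hd⟩
      (SmallDefinable.fibre hm hM ((Cardinal.lt_aleph0_of_finite γ).trans hm.1) c hT)⟩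
  · rintro S T ⟨T', hTT', hT'⟩ hST
    exact ⟨T', hST.trans hTT', hT'⟩
  · rintro S T ⟨S', hSS', hS'⟩ ⟨T', hTT', hT'⟩
    exact ⟨S' ∪ T', Set.union_subset_union hSS' hTT', hS'.union hm hT'⟩
  · rintro β hβ I hI T hT k ⟨S', hSS', hS'⟩
    exact ⟨_, subset_rfl, StablyNull.of_morley h𝓘 hm hMel hM hβ hI hT k
      (hS'.mono h𝓘 hm (smallDefinable_forall_lt hm hM hβ hT I k) hSS')⟩
  · rintro ⟨S', hSS', hS'⟩
    rw [Set.univ_subset_iff.1 hSS'] at hS'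
    exact StablyNull.not_univ h𝓘 hM (HeirSmall.not_univ hMel) hm hS'

theorem IsUltraMorley.map_symm {M : Set 𝕄} {β : Type v} {I : ℕ → β → 𝕄} (σ : 𝕄 ≃[L] 𝕄)
    (h : IsUltraMorley L (σ '' M) I) : IsUltraMorley L M fun i => ⇑σ.symm ∘ I i := by
  obtain ⟨V, hV, hVI⟩ := h
  refine ⟨V.map (⇑σ.symm ∘ ·), ?_, fun i S hS hSV => ?_⟩
  · change (⇑σ.symm ∘ ·) ⁻¹' tuplesIn M β ∈ V
    refine Filter.mem_of_superset hV fun x hx j => ?_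
    obtain ⟨m, hm, hmx⟩ := hx j
    change σ.symm (x j) ∈ M
    rwa [← hmx, show σ.symm (σ m) = m from σ.symm_apply_apply m]
  · have hdef : (initialSet (σ '' M) I i).Definable L {x | ⇑σ.symm ∘ x ∈ S} := by
      refine definable_preimage_equiv σ.symm (hS.mono (initialSet_subset ?_ ?_))
      · exact fun m hm => ⟨σ m, subset_initialSet _ _ ⟨m, hm, rfl⟩, σ.symm_apply_apply m⟩
      · exact fun j hj x => ⟨_, mem_initialSet_of_lt I hj x, rfl⟩
    exact hVI i _ hdef hSV

namespace IsKimIdeal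

variable {M : Set 𝕄} {α : Type v} {a b : α → 𝕄} {F : Set (α → 𝕄) → Prop}

theorem congr (hab : SameType L M a b) (h : IsKimIdeal L κ M a F) : IsKimIdeal L κ M b F :=
  ⟨fun hS => h.heir (hS.congr hab.symm), h.mono, h.union, h.kim⟩

theorem comp {ι : Type w} (h : IsKimIdeal L κ M a F) (f : ι → α) :
    IsKimIdeal L κ M (a ∘ f) fun S => F {x | x ∘ f ∈ S} where
  heir := by
    rintro S ⟨γ, hγ, c, T, hT, hST, hd⟩
    have h1 : ∀ (x : α → 𝕄) (e : γ → 𝕄),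
        Sum.elim x e ∘ Sum.map f id = Sum.elim (x ∘ f) e :=
      fun x e => by ext (i | i) <;> rfl
    refine h.heir ⟨γ, hγ, c, {v | v ∘ Sum.map f id ∈ T}, definable_relabel hT _, ?_, ?_⟩
    · intro x hx
      change Sum.elim x c ∘ Sum.map f id ∈ T
      rw [h1]
      exact hST hx
    · intro d hdM hdT
      rw [Set.mem_ofPred_eq, h1] at hdT
      exact hd d hdM hdT
  mono := fun hT hST => h.mono hT fun _ hx => hST hx
  union := fun hS hT => h.union hS hT
  kim := by
    intro β hβ I hI T hT k hF
    have h1 : ∀ (x : α → 𝕄) (e : β → 𝕄),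
        Sum.elim x e ∘ Sum.map f id = Sum.elim (x ∘ f) e :=
      fun x e => by ext (i | i) <;> rfl
    have := h.kim hβ hI (T := {v | v ∘ Sum.map f id ∈ T}) (definable_relabel hT _) k
    simp only [fibre, Set.mem_ofPred_eq, h1] at this
    exact this hF

theorem map (h : IsKimIdeal L κ M a F) (σ : 𝕄 ≃[L] 𝕄) :
    IsKimIdeal L κ (σ '' M) (⇑σ ∘ a) fun S => F {x | ⇑σ ∘ x ∈ S} where
  heir := fun hS => h.heir hS.preimage
  mono := fun hT hST => h.mono hT fun _ hx => hST hx
  union := fun hS hT => h.union hS hT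
  kim := by
    intro β hβ I hI T hT k hF
    have := h.kim hβ (hI.map_symm σ) (T := {v | ⇑σ ∘ v ∈ T}) (definable_preimage_equiv σ hT) k
    simp only [fibre, Set.mem_ofPred_eq, comp_sum_elim, comp_symm_comp] at this
    exact this hF

end IsKimIdeal

namespace KimIndep

variable {M : Set 𝕄} {α : Type v} {a : α → 𝕄} {C D : Set 𝕄}

theorem mono (h : KimIndep L κ M a D) (hCD : C ⊆ M ∪ D) : KimIndep L κ M a C := by
  obtain ⟨F, hF, hFa⟩ := h
  exact ⟨F, hF, fun S hS hSC =>
    hFa S hS (hSC.mono (Set.union_subset Set.subset_union_left hCD))⟩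

theorem of_range_subset {ι : Type w} {a' : ι → 𝕄} (h : KimIndep L κ M a C)
    (ha' : Set.range a' ⊆ Set.range a) : KimIndep L κ M a' C := by
  obtain ⟨F, hF, hFa⟩ := h
  choose f hf using fun i => ha' ⟨i, rfl⟩
  obtain rfl : a ∘ f = a' := funext hf
  exact ⟨_, hF.comp f, fun S hS hSC => hFa _ hS (definable_relabel hSC f)⟩

theorem map (h : KimIndep L κ M a C) (σ : 𝕄 ≃[L] 𝕄) :
    KimIndep L κ (σ '' M) (⇑σ ∘ a) (σ '' C) := by
  obtain ⟨F, hF, hFa⟩ := h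
  refine ⟨_, hF.map σ, fun S hS hSC => hFa _ hS (definable_preimage_equiv σ ?_)⟩
  rwa [Set.image_union]

end KimIndep

theorem IsKimIdeal.exists_avoiding (hm : IsMonster L 𝕄 κ) {M : Set 𝕄} {α : Type u}
    (hα : Cardinal.mk α < κ) {a : α → 𝕄} {F : Set (α → 𝕄) → Prop} (hF : IsKimIdeal L κ M a F)
    {C : Set 𝕄} (hC : Cardinal.mk C < κ) (𝒢 : Filter (α → 𝕄)) (h : ∀ G ∈ 𝒢, ¬ F G) :
    ∃ a' : α → 𝕄, (∀ S ∈ 𝒢, C.Definable L S → a' ∈ S) ∧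
      ∀ S, F S → C.Definable L S → a' ∉ S := by
  have hempty : F ∅ := hF.heir (HeirSmall.isInvariantIdeal M a).empty
  let ℱ : Filter (α → 𝕄) :=
    { sets := {Y | ∃ G ∈ 𝒢, F (G \ Y)}
      univ_sets := ⟨Set.univ, Filter.univ_mem, by rwa [Set.sdiff_univ]⟩
      sets_of_superset := fun ⟨G, hG, hGY⟩ hY =>
        ⟨G, hG, hF.mono hGY (Set.sdiff_subset_sdiff_right hY)⟩
      inter_sets := fun ⟨G, hG, hGY⟩ ⟨G', hG', hGY'⟩ =>
        ⟨G ∩ G', Filter.inter_mem hG hG', hF.mono (hF.union hGY hGY') (by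
          rintro x ⟨⟨hx, hx'⟩, hxY⟩
          by_contra hcon
          exact hxY ⟨by_contra fun hn => hcon (Or.inl ⟨hx, hn⟩),
            by_contra fun hn => hcon (Or.inr ⟨hx', hn⟩)⟩)⟩ }
  have : ℱ.NeBot := Filter.neBot_iff.2 fun hbot => by
    obtain ⟨G, hG, hGF⟩ := Filter.empty_mem_iff_bot.2 hbot
    rw [Set.sdiff_empty] at hGF
    exact h G hG hGF
  obtain ⟨a', ha'⟩ := exists_realization hm.2.1 hα hC ℱ
  refine ⟨a', fun S hS hSC => ha' S ⟨S, hS, by rwa [Set.sdiff_self]⟩ hSC, fun S hS hSC => ?_⟩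
  exact ha' Sᶜ ⟨Set.univ, Filter.univ_mem, hF.mono hS fun x hx => by simpa using hx.2⟩ hSC.compl

theorem KimIndep.extend (hm : IsMonster L 𝕄 κ) {M B C : Set 𝕄} (hM : Cardinal.mk M < κ)
    (hC : Cardinal.mk C < κ) (hBC : B ⊆ C) {α : Type u} (hα : Cardinal.mk α < κ) {a : α → 𝕄}
    (h : KimIndep L κ M a B) :
    ∃ a', SameType L (M ∪ B) a' a ∧ KimIndep L κ M a' C := by
  obtain ⟨F, hF, hFa⟩ := h
  obtain ⟨a', ha', hFa'⟩ := hF.exists_avoiding hm hα (hm.union_lt hM hC)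
    (typeFilter L (M ∪ B) a) (by
      rintro G ⟨D, hD, haD, hDG⟩ hG
      exact hFa D (hF.mono hG hDG) hD haD)
  have htp : SameType L (M ∪ B) a a' := SameType.of_imp fun S hS haS =>
    ha' S ⟨S, hS, haS, subset_rfl⟩ (hS.mono (Set.union_subset_union_right M hBC))
  exact ⟨a', htp.symm, F, hF.congr (htp.mono Set.subset_union_left), hFa'⟩

theorem KimIndep.chain (hm : IsMonster L 𝕄 κ) {M : Set 𝕄} (hM : Cardinal.mk M < κ)
    {α β : Type u} (hα : Cardinal.mk α < κ) (hβ : Cardinal.mk β < κ) {a : α → 𝕄}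
    {I : ℕ → β → 𝕄} (hI : IsUltraMorley L M I) (h : KimIndep L κ M a (Set.range (I 0))) :
    ∃ σ : 𝕄 ≃[L] 𝕄, (∀ m ∈ M, σ m = m) ∧ KimIndep L κ M a (⋃ i, Set.range (⇑σ ∘ I i)) ∧
      ∀ i, SameType L (M ∪ Set.range a) (⇑σ ∘ I i) (I 0) := by
  obtain ⟨F, hF, hFa⟩ := h
  let 𝒢 : Filter (α → 𝕄) :=
    { sets := {Y | ∃ (k : ℕ) (S : Set (α ⊕ β → 𝕄)), M.Definable L S ∧ Sum.elim a (I 0) ∈ S ∧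
        {x | ∀ i < k, x ∈ fibre S (I i)} ⊆ Y}
      univ_sets := ⟨0, Set.univ, Set.definable_univ, trivial, Set.subset_univ _⟩
      sets_of_superset := fun ⟨k, S, h1, h2, h3⟩ hY => ⟨k, S, h1, h2, h3.trans hY⟩
      inter_sets := fun ⟨k, S, h1, h2, h3⟩ ⟨k', S', h1', h2', h3'⟩ =>
        ⟨max k k', S ∩ S', h1.inter h1', ⟨h2, h2'⟩, fun x hx =>
          ⟨h3 fun i hi => (hx i (lt_max_of_lt_left hi)).1,
            h3' fun i hi => (hx i (lt_max_of_lt_right hi)).2⟩⟩ }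
  have hsmall : Cardinal.mk ↑(M ∪ ⋃ i, Set.range (I i)) < κ :=
    hm.union_lt hM (hm.iUnion_range_lt hβ I)
  obtain ⟨a', ha', hFa'⟩ := hF.exists_avoiding hm hα hsmall 𝒢 (by
    rintro G ⟨k, S, hS, haS, hSG⟩ hG
    exact hFa _ (hF.kim hβ hI hS k (hF.mono hG hSG))
      (definable_slice (hS.mono Set.subset_union_left) fun j => Or.inr ⟨j, rfl⟩) haS)
  have hI' : ∀ i j, I i j ∈ M ∪ ⋃ i, Set.range (I i) := fun i j =>
    Or.inr (Set.mem_iUnion.2 ⟨i, j, rfl⟩)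
  have htp : ∀ i, SameType L M (Sum.elim a (I 0)) (Sum.elim a' (I i)) := fun i =>
    SameType.of_imp fun S hS haS => ha' (fibre S (I i))
      ⟨i + 1, S, hS, haS, fun x hx => hx i i.lt_succ_self⟩
      (definable_slice (hS.mono Set.subset_union_left) (hI' i))
  have htpa : SameType L M a a' := (htp 0).comp Sum.inl
  obtain ⟨σ, hσ, hσa⟩ := hm.exists_equiv hα hM htpa.symm
  refine ⟨σ, hσ, ?_, fun i => ?_⟩
  · have hind : KimIndep L κ M a' (⋃ i, Set.range (I i)) := ⟨F, hF.congr htpa, hFa'⟩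
    have := hind.map σ
    rw [hσa, HeirSmall.image_eq_of_fixes hσ, Set.image_iUnion] at this
    simpa only [Set.range_comp] using this
  · refine SameType.of_sum_elim fun S hS => ?_
    rw [← hσa, ← comp_sum_elim, comp_mem_iff_of_fixes hσ hS, hσa]
    exact (htp i S hS).symm

theorem KimIndep.of_isElemSubmodel (hm : IsMonster L 𝕄 κ) {M : Set 𝕄}
    (hMel : IsElemSubmodel L M) (hM : Cardinal.mk M < κ) {α : Type v} (a : α → 𝕄) :
    KimIndep L κ M a M := by
  obtain ⟨F, hF, huniv⟩ := exists_isKimIdeal hm hMel hM a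
  refine ⟨F, hF, fun S hS hSM haS => huniv ?_⟩
  rw [Set.union_self] at hSM
  rw [← Set.union_compl_self S]
  exact hF.union hS (hF.heir (HeirSmall.of_definable hSM.compl fun h => h haS))

theorem CoheirMorley.isUltraMorley {M : Set 𝕄} {β : Type v} {I : ℕ → β → 𝕄}
    (h : CoheirMorley L M I) : IsUltraMorley L M I := by
  classical
  obtain ⟨q, hq, hqI⟩ := h
  let 𝒢 : Filter (β → 𝕄) :=
    { sets := {Y | ∃ t : Finset (FmlP L 𝕄 β), ↑t ⊆ q.carrier ∧ ∀ m ∈ tuplesIn M β,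
        (∀ p ∈ t, p.2.1.Realize (Sum.elim m p.2.2)) → m ∈ Y}
      univ_sets := ⟨∅, by simp, fun _ _ _ => trivial⟩
      sets_of_superset := fun ⟨t, ht, h⟩ hY => ⟨t, ht, fun m hm hmt => hY (h m hm hmt)⟩
      inter_sets := fun ⟨t, ht, h⟩ ⟨t', ht', h'⟩ =>
        ⟨t ∪ t', by rw [Finset.coe_union]; exact Set.union_subset ht ht', fun m hm hmt =>
          ⟨h m hm fun p hp => hmt p (Finset.mem_union_left _ hp),
            h' m hm fun p hp => hmt p (Finset.mem_union_right _ hp)⟩⟩ }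
  have : 𝒢.NeBot := Filter.neBot_iff.2 fun hbot => by
    obtain ⟨t, ht, h⟩ := Filter.empty_mem_iff_bot.2 hbot
    obtain ⟨m, hmM, hm⟩ := hq t ht
    exact h m hmM hm
  refine ⟨Ultrafilter.of 𝒢,
    Ultrafilter.of_le 𝒢 ⟨∅, by simp, fun _ hm _ => hm⟩, fun i S hS hSV => ?_⟩
  obtain ⟨n, φ, c, hc, rfl⟩ := definable_iff_exists_fin.1 hS
  rcases q.complete n φ c with hφ | hφ
  · exact hqI i n φ c hc hφ
  · refine absurd hSV (Ultrafilter.compl_mem_iff_notMem.1 (Ultrafilter.of_le 𝒢 ?_))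
    exact ⟨{⟨n, φ.not, c⟩}, by simpa using hφ, fun m _ hm => by simpa using hm⟩

theorem exists_definable_fin {α γ : Type*} {C : Set 𝕄} {T : Set (α ⊕ γ → 𝕄)}
    (hT : C.Definable L T) : ∃ (n : ℕ) (T' : Set (α ⊕ Fin n → 𝕄)) (f : Fin n → γ),
      Function.Injective f ∧ C.Definable L T' ∧
        ∀ (x : α → 𝕄) (c : γ → 𝕄), Sum.elim x c ∈ T ↔ Sum.elim x (c ∘ f) ∈ T' := by
  obtain ⟨φ, rfl⟩ := Set.definable_iff_exists_formula_sum.1 hT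
  obtain ⟨n, ψ, f, hf, hψ⟩ := exists_formula_fin (𝕄 := 𝕄)
    (φ.relabel (Equiv.sumAssoc C α γ).symm)
  refine ⟨n, _, f, hf, Set.definable_iff_exists_formula_sum.2
    ⟨ψ.relabel (Equiv.sumAssoc C α (Fin n)), rfl⟩, fun x c => ?_⟩
  have := hψ (Sum.elim (fun m : C => (m : 𝕄)) x) c
  rw [Formula.realize_relabel] at this
  simp only [Set.mem_ofPred_eq, Formula.realize_relabel]
  convert this using 2
  · ext v
    rcases v with v | v | v <;> rfl
  · ext v
    rcases v with (v | v) | v <;> rfl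

theorem KimIndep.finSatIn {M : Set 𝕄} (hM : IsElemSubmodel L M) {α : Type v} {a : α → 𝕄}
    {β : Type w} {b : β → 𝕄} (h : KimIndep L κ M a (Set.range b)) :
    FinSatIn L M b (M ∪ Set.range a) := by
  intro n φ c hc hφ
  obtain ⟨F, hF, hFa⟩ := h
  by_contra! hcon
  obtain ⟨T, hT, hYT⟩ := exists_slice (C := M) (c := a)
    (definable_iff_exists_fin.2 ⟨n, φ, c, hc, rfl⟩)
  obtain ⟨k, T', f, hf, hT', hTT'⟩ := exists_definable_fin (definable_relabel hT Sum.swap)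
  have hswap : ∀ y : β → 𝕄, Sum.elim a y ∘ Sum.swap = Sum.elim y a := fun y => by
    ext (i | i) <;> rfl
  have key : ∀ y : β → 𝕄, φ.Realize (Sum.elim y c) ↔ Sum.elim a (y ∘ f) ∈ T' := fun y => by
    rw [← hTT' a y, Set.mem_ofPred_eq, hswap]
    exact Set.ext_iff.1 hYT y
  have hmem : a ∈ fibre T' (b ∘ f) := (key b).1 hφ
  refine hFa _ (hF.heir ⟨ULift (Fin k), inferInstance, b ∘ f ∘ ULift.down,
    {v | v ∘ Sum.map id ULift.up ∈ T'}, definable_relabel hT' _, ?_, ?_⟩)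
    (definable_slice (hT'.mono Set.subset_union_left) fun j => Or.inr ⟨f j, rfl⟩) hmem
  · intro x hx
    change Sum.elim x (b ∘ f ∘ ULift.down) ∘ Sum.map id ULift.up ∈ T'
    rw [show Sum.elim x (b ∘ f ∘ ULift.down) ∘ Sum.map id ULift.up = Sum.elim x (b ∘ f) by
      ext (i | i) <;> rfl]
    exact hx
  · intro d hd hdT
    rw [Set.mem_ofPred_eq, show Sum.elim a d ∘ Sum.map id ULift.up =
      Sum.elim a (d ∘ ULift.up) by ext (i | i) <;> rfl] at hdT
    have hext : ∃ m : β → 𝕄, (∀ i, m i ∈ M) ∧ m ∘ f = d ∘ ULift.up := by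
      rcases isEmpty_or_nonempty β with hβ | ⟨⟨x⟩⟩
      · exact ⟨b, fun i => hβ.elim i, funext fun i => hβ.elim (f i)⟩
      · have : Nonempty 𝕄 := ⟨b x⟩
        obtain ⟨m₀, hm₀⟩ := hM.nonempty
        refine ⟨Function.extend f (d ∘ ULift.up) fun _ => m₀, fun i => ?_,
          funext fun i => hf.extend_apply _ _ _⟩
        by_cases hi : ∃ j, f j = i
        · obtain ⟨j, rfl⟩ := hi
          rw [hf.extend_apply]
          exact hd _
        · rw [Function.extend_apply' _ _ _ hi]
          exact hm₀
    obtain ⟨m, hmM, hmf⟩ := hext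
    exact hcon m hmM ((key m).2 (by rwa [hmf]))

/-- The relation of Kim-independence with respect to some ideal. -/
def kimRel (L : FirstOrder.Language.{u, u}) (𝕄 : Type u) [L.Structure 𝕄] (κ : Cardinal.{u}) :
    IndRel L 𝕄 :=
  ⟨fun A M B => KimIndep L κ M (Subtype.val : A → 𝕄) B⟩

theorem kimRel_range {M B : Set 𝕄} {α : Type v} {a : α → 𝕄} :
    (kimRel L 𝕄 κ).rel (Set.range a) M B ↔ KimIndep L κ M a B :=
  ⟨fun h => h.of_range_subset Subtype.range_coe.ge,
    fun h => h.of_range_subset Subtype.range_coe.le⟩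

theorem goodRel_kimRel (hm : IsMonster L 𝕄 κ) : GoodRel (kimRel L 𝕄 κ) κ := by
  refine ⟨?_, ?_, ?_, ?_, ?_, ?_⟩
  · intro A M B hM h
    have h' : KimIndep L κ M (Subtype.val : A → 𝕄) (Set.range (Subtype.val : B → 𝕄)) := by
      rw [Subtype.range_coe]
      exact h
    have := h'.finSatIn hM
    rwa [Subtype.range_coe] at this
  · intro σ A M B h
    refine (KimIndep.map h σ).of_range_subset ?_
    rw [Subtype.range_coe, Set.range_comp, Subtype.range_coe]
  · intro A A' M B B' _ h _ hA _ hB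
    refine (KimIndep.mono h (hB.trans Set.subset_union_right)).of_range_subset ?_
    rwa [Subtype.range_coe, Subtype.range_coe]
  · intro M hMel hM α β hα hβ a b
    obtain ⟨a₁, hta₁, ha₁⟩ := (KimIndep.of_isElemSubmodel hm hMel hM
      (Sum.elim a (Subtype.val : M → 𝕄))).extend hm hM (hm.union_lt hM (mk_range_lt hβ b))
        Set.subset_union_left (hm.sum_lt hα hM)
    rw [Set.union_self] at hta₁
    obtain ⟨σ, hσ, rfl⟩ := hm.exists_equiv (hm.sum_lt hα hM) hM hta₁.symm
    refine ⟨⇑σ ∘ a, sameType_iff_eqTpOver.1 (SameType.of_fixes hσ a),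
      ha₁.of_range_subset ?_⟩
    rw [Subtype.range_coe]
    rintro x (hx | ⟨i, rfl⟩)
    · exact ⟨Sum.inr ⟨x, hx⟩, hσ x hx⟩
    · exact ⟨Sum.inl i, rfl⟩
  · intro M _ hM α hα a B C _ hC h hBC
    obtain ⟨a', hta, ha'⟩ := (kimRel_range.1 h).extend hm hM hC hBC hα
    exact ⟨a', sameType_iff_eqTpOver.1 (hta.mono Set.subset_union_right), kimRel_range.2 ha'⟩
  · rintro M _ hM α β hα hβ a b h I hI rfl
    obtain ⟨σ, hσ, hind, htp⟩ :=
      (kimRel_range.1 h).chain hm hM hα hβ hI.isUltraMorley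
    exact ⟨fun i => ⇑σ ∘ I i, sameType_iff_eqTpOver.1 (SameType.of_fixes hσ (flatSeq I)),
      kimRel_range.2 hind, fun i => sameType_iff_eqTpOver.1 (htp i)⟩

/-- The union of all relations with the required properties. -/
def weakestRel (L : FirstOrder.Language.{u, u}) (𝕄 : Type u) [L.Structure 𝕄]
    (κ : Cardinal.{u}) : IndRel L 𝕄 :=
  ⟨fun A M B => ∃ R : IndRel L 𝕄, GoodRel R κ ∧ R.rel A M B⟩

theorem goodRel_weakestRel (hm : IsMonster L 𝕄 κ) : GoodRel (weakestRel L 𝕄 κ) κ := by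
  refine ⟨?_, ?_, ?_, ?_, ?_, ?_⟩
  · rintro A M B hM ⟨R, hR, h⟩
    exact hR.1 A M B hM h
  · rintro σ A M B ⟨R, hR, h⟩
    exact ⟨R, hR, hR.2.1 σ A M B h⟩
  · rintro A A' M B B' hM ⟨R, hR, h⟩ h1 h2 h3 h4
    exact ⟨R, hR, hR.2.2.1 A A' M B B' hM h h1 h2 h3 h4⟩
  · intro M hMel hM α β hα hβ a b
    have hR := goodRel_kimRel hm
    obtain ⟨a', h1, h2⟩ := hR.2.2.2.1 M hMel hM α β hα hβ a b
    exact ⟨a', h1, _, hR, h2⟩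
  · rintro M hMel hM α hα a B C hB hC ⟨R, hR, h⟩ hBC
    obtain ⟨a', h1, h2⟩ := hR.2.2.2.2.1 M hMel hM α hα a B C hB hC h hBC
    exact ⟨a', h1, R, hR, h2⟩
  · rintro M hMel hM α β hα hβ a b ⟨R, hR, h⟩ I hI hI0
    obtain ⟨I', h1, h2, h3⟩ := hR.2.2.2.2.2 M hMel hM α β hα hβ a b h I hI hI0
    exact ⟨I', h1, ⟨R, hR, h2⟩, h3⟩

end Independence

/-- **Proposition 3.1.** In any complete first-order theory, among the
relations `⫝` between small subsets of `𝕄` over elementary submodels that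
imply `⫝ʰ` and satisfy invariance, monotonicity, existence, right extension
and the coheir chain condition, there is a weakest one, `⫝^CK`. -/
theorem ck_exists (L : FirstOrder.Language.{u, u}) (𝕄 : Type u) [L.Structure 𝕄]
    (κ : Cardinal.{u}) (hmonster : IsMonster L 𝕄 κ) :
    ∃ R : IndRel L 𝕄, GoodRel R κ ∧
      ∀ R' : IndRel L 𝕄, GoodRel R' κ →
        ∀ A Ms B : Set 𝕄, R'.rel A Ms B → R.rel A Ms B := by
  exact ⟨weakestRel L 𝕄 κ, goodRel_weakestRel hmonster, fun R' hR' A Ms B h => ⟨R', hR', h⟩⟩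

end NSOP2Paper
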